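/- arXiv:2512.11152 — 2 statements merged into one kernel-verified Lean document; each statement's English description precedes it below -/
import Mathlib

section
/- Let d ≥ 3 and δ > 0. There exist η₀ > 0 depending on δ and d, and a constant C depending on δ and d, such that: if v is a solution of the hodograph PDE on H₁ = {y : y_d ≥ 0, |y| ≥ 1} with |∇v(y)| ≤ η₀ on H₁, and v is bounded from above or bounded from below, then (the limit v_∞ := lim_{|y|→∞, y∈H₁} v(y) exists and) for all y ∈ H₁ one has |y|^{d−2−δ} · |v(y) − v_∞| ≤ C · osc_K v, where osc_K v is the oscillation of v over K = {y : 1 ≤ |y| ≤ 2, y_d ≥ 0}. -/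
open Real Set Filter MeasureTheory

noncomputable section

/-- The last index of `Fin d`. -/
def lastIdx (d : ℕ) (hd : 0 < d) : Fin d := ⟨d - 1, by omega⟩

/-- The `i`-th partial derivative of `v` at `y`. -/
def gradC (d : ℕ) (v : EuclideanSpace ℝ (Fin d) → ℝ)
    (y : EuclideanSpace ℝ (Fin d)) (i : Fin d) : ℝ :=
  fderiv ℝ v y (EuclideanSpace.single i 1)

/-- The `(i,j)` entry of the Hessian of `v` at `y`. -/
def hessC (d : ℕ) (v : EuclideanSpace ℝ (Fin d) → ℝ)
    (y : EuclideanSpace ℝ (Fin d)) (i j : Fin d) : ℝ :=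
  fderiv ℝ (fun z => fderiv ℝ v z (EuclideanSpace.single i 1)) y (EuclideanSpace.single j 1)

/-- The squared euclidean norm of the tangential part `p'` of `p`. -/
def tangSq (d : ℕ) (hd : 0 < d) (p : Fin d → ℝ) : ℝ :=
  ∑ m : Fin d, if m = lastIdx d hd then 0 else (p m) ^ 2

/-- The coefficient matrix `A(p)` of the hodograph PDE. -/
def hodA (d : ℕ) (hd : 0 < d) (p : Fin d → ℝ) (i j : Fin d) : ℝ :=
  if i = lastIdx d hd then
    (if j = lastIdx d hd then (1 + tangSq d hd p) / (1 + p (lastIdx d hd)) ^ 2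
     else p j / (1 + p (lastIdx d hd)))
  else
    (if j = lastIdx d hd then p i / (1 + p (lastIdx d hd))
     else if i = j then 1 else 0)

/-- The boundary nonlinearity `N(p') = √(1 + |p'|²) - 1`. -/
def hodN (d : ℕ) (hd : 0 < d) (p : Fin d → ℝ) : ℝ :=
  Real.sqrt (1 + tangSq d hd p) - 1

/-- The quantity `tr(A(∇v(y)) D²v(y))`. -/
def hodOp (d : ℕ) (hd : 0 < d) (v : EuclideanSpace ℝ (Fin d) → ℝ)
    (y : EuclideanSpace ℝ (Fin d)) : ℝ :=
  ∑ i : Fin d, ∑ j : Fin d, hodA d hd (fun m => gradC d v y m) i j * hessC d v y i j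

/-- `v` is `C^∞` on an open neighborhood of `U`. -/
def SmoothNear (d : ℕ) (v : EuclideanSpace ℝ (Fin d) → ℝ)
    (U : Set (EuclideanSpace ℝ (Fin d))) : Prop :=
  ∃ W : Set (EuclideanSpace ℝ (Fin d)), IsOpen W ∧ U ⊆ W ∧ ContDiffOn ℝ (⊤ : ℕ∞) v W

/-- `v` is a (classical) solution of the hodograph PDE on `U`. -/
def IsHodSol (d : ℕ) (hd : 0 < d) (v : EuclideanSpace ℝ (Fin d) → ℝ)
    (U : Set (EuclideanSpace ℝ (Fin d))) : Prop :=
  SmoothNear d v U ∧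
  (∀ y ∈ U, 0 < y (lastIdx d hd) → hodOp d hd v y = 0) ∧
  (∀ y ∈ U, y (lastIdx d hd) = 0 →
    gradC d v y (lastIdx d hd) = hodN d hd (fun m => gradC d v y m))

/-- `v` is a subsolution of the hodograph PDE on `U`. -/
def IsHodSubsol (d : ℕ) (hd : 0 < d) (v : EuclideanSpace ℝ (Fin d) → ℝ)
    (U : Set (EuclideanSpace ℝ (Fin d))) : Prop :=
  SmoothNear d v U ∧
  (∀ y ∈ U, 0 < y (lastIdx d hd) → 0 ≤ hodOp d hd v y) ∧
  (∀ y ∈ U, y (lastIdx d hd) = 0 →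
    hodN d hd (fun m => gradC d v y m) ≤ gradC d v y (lastIdx d hd))

/-- `v` is a supersolution of the hodograph PDE on `U`. -/
def IsHodSupersol (d : ℕ) (hd : 0 < d) (v : EuclideanSpace ℝ (Fin d) → ℝ)
    (U : Set (EuclideanSpace ℝ (Fin d))) : Prop :=
  SmoothNear d v U ∧
  (∀ y ∈ U, 0 < y (lastIdx d hd) → hodOp d hd v y ≤ 0) ∧
  (∀ y ∈ U, y (lastIdx d hd) = 0 →
    gradC d v y (lastIdx d hd) ≤ hodN d hd (fun m => gradC d v y m))

/-- The exterior half-space domain `H₁ = {y : y_d ≥ 0, |y| ≥ 1}`. -/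
def extDom (d : ℕ) (hd : 0 < d) : Set (EuclideanSpace ℝ (Fin d)) :=
  {y | 0 ≤ y (lastIdx d hd) ∧ 1 ≤ ‖y‖}

/-- The half annulus `A_r = {y : 1 ≤ |y| ≤ r, y_d ≥ 0}`. -/
def halfAnn (d : ℕ) (hd : 0 < d) (r : ℝ) : Set (EuclideanSpace ℝ (Fin d)) :=
  {y | 0 ≤ y (lastIdx d hd) ∧ 1 ≤ ‖y‖ ∧ ‖y‖ ≤ r}

/-- The upper half sphere `∂B_ρ⁺ = {y : y_d ≥ 0, |y| = ρ}`. -/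
def upSphere (d : ℕ) (hd : 0 < d) (ρ : ℝ) : Set (EuclideanSpace ℝ (Fin d)) :=
  {y | 0 ≤ y (lastIdx d hd) ∧ ‖y‖ = ρ}

/-- The filter of `|y| → ∞` within `H₁`. -/
def farFilter (d : ℕ) (hd : 0 < d) : Filter (EuclideanSpace ℝ (Fin d)) :=
  (Filter.comap (fun y : EuclideanSpace ℝ (Fin d) => ‖y‖) Filter.atTop) ⊓
    Filter.principal (extDom d hd)

/-- The function `t ↦ f (y + t • w)` is twice differentiable at `0`, with second derivative `q`. -/
def HasSecondDirDeriv {E : Type*} [NormedAddCommGroup E] [NormedSpace ℝ E]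
    (f : E → ℝ) (y w : E) (q : ℝ) : Prop :=
  ∃ g : ℝ → ℝ, (∀ᶠ t in nhds (0 : ℝ), HasDerivAt (fun t : ℝ => f (y + t • w)) (g t) t) ∧
    HasDerivAt g q 0

namespace HasSecondDirDeriv

variable {E : Type*} [NormedAddCommGroup E] [NormedSpace ℝ E] {f f₁ f₂ : E → ℝ} {y w : E}
  {q q₁ q₂ : ℝ}

theorem const (c : ℝ) (y w : E) : HasSecondDirDeriv (fun _ => c) y w 0 :=
  ⟨fun _ => 0, Eventually.of_forall fun _ => hasDerivAt_const _ _, hasDerivAt_const _ _⟩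

theorem add (h₁ : HasSecondDirDeriv f₁ y w q₁) (h₂ : HasSecondDirDeriv f₂ y w q₂) :
    HasSecondDirDeriv (fun z => f₁ z + f₂ z) y w (q₁ + q₂) := by
  obtain ⟨g₁, hg₁, hq₁⟩ := h₁
  obtain ⟨g₂, hg₂, hq₂⟩ := h₂
  refine ⟨fun t => g₁ t + g₂ t, ?_, hq₁.add hq₂⟩
  filter_upwards [hg₁, hg₂] with t h₁ h₂ using h₁.add h₂

theorem const_mul (c : ℝ) (h : HasSecondDirDeriv f y w q) :
    HasSecondDirDeriv (fun z => c * f z) y w (c * q) := by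
  obtain ⟨g, hg, hq⟩ := h
  refine ⟨fun t => c * g t, ?_, hq.const_mul c⟩
  filter_upwards [hg] with t h using h.const_mul c

theorem comp_sub (x : E) (h : HasSecondDirDeriv f (y - x) w q) :
    HasSecondDirDeriv (fun z => f (z - x)) y w q := by
  obtain ⟨g, hg, hq⟩ := h
  refine ⟨g, ?_, hq⟩
  simpa only [add_sub_right_comm] using hg

theorem nonneg_of_isLocalMin (h : HasSecondDirDeriv f y w q) (hmin : IsLocalMin f y) : 0 ≤ q := by
  obtain ⟨g, hg, hq⟩ := h
  by_contra! hneg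
  set k : ℝ → ℝ := fun t => f (y + t • w) with hk
  have hline : ContinuousAt (fun t : ℝ => y + t • w) 0 := by fun_prop
  have hkmin : IsLocalMin k 0 := by
    have : ∀ᶠ z in nhds (y + (0 : ℝ) • w), f y ≤ f z := by
      rw [zero_smul, add_zero]
      exact hmin
    filter_upwards [hline.eventually this] with t ht
    simpa [hk] using ht
  have hderiv : deriv k =ᶠ[nhds 0] g := by
    filter_upwards [hg] with t ht using ht.deriv
  have hdd : deriv (deriv k) 0 = q := by rw [hderiv.deriv_eq, hq.deriv]
  have hmax : IsLocalMax k 0 :=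
    isLocalMax_of_deriv_deriv_neg (by rw [hdd]; exact hneg) hkmin.deriv_eq_zero
      hg.self_of_nhds.continuousAt
  have hconst : k =ᶠ[nhds 0] fun _ => k 0 := by
    filter_upwards [hkmin, hmax] with t h₁ h₂ using le_antisymm h₂ h₁
  have : deriv k =ᶠ[nhds 0] fun _ => (0 : ℝ) := by
    have := hconst.deriv
    simpa using this
  have h0 : deriv (deriv k) 0 = 0 := by rw [this.deriv_eq]; simp
  linarith

end HasSecondDirDeriv

/-- The value at `y` of the second order operator `∑ k, ∂²_{w k}` (off the hyperplane `y n = 0`),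
respectively of the oblique derivative `∂_ν` (on that hyperplane), applied to `f`, is `c`. -/
def HasFrameOp {d : ℕ} (n : Fin d) (w : Fin d → EuclideanSpace ℝ (Fin d))
    (ν : EuclideanSpace ℝ (Fin d)) (f : EuclideanSpace ℝ (Fin d) → ℝ)
    (y : EuclideanSpace ℝ (Fin d)) (c : ℝ) : Prop :=
  (0 < y n → ∃ q : Fin d → ℝ, (∀ k, HasSecondDirDeriv f y (w k) (q k)) ∧ ∑ k, q k = c) ∧
  (y n = 0 → HasDerivAt (fun t : ℝ => f (y + t • ν)) c 0)

namespace HasFrameOp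

variable {d : ℕ} {n : Fin d} {w : Fin d → EuclideanSpace ℝ (Fin d)}
  {ν : EuclideanSpace ℝ (Fin d)} {f f₁ f₂ : EuclideanSpace ℝ (Fin d) → ℝ}
  {y : EuclideanSpace ℝ (Fin d)} {c c₁ c₂ : ℝ}

theorem const (a : ℝ) : HasFrameOp n w ν (fun _ => a) y 0 :=
  ⟨fun _ => ⟨fun _ => 0, fun _ => .const a _ _, by simp⟩, fun _ => hasDerivAt_const _ _⟩

theorem add (h₁ : HasFrameOp n w ν f₁ y c₁) (h₂ : HasFrameOp n w ν f₂ y c₂) :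
    HasFrameOp n w ν (fun z => f₁ z + f₂ z) y (c₁ + c₂) := by
  refine ⟨fun hy => ?_, fun hy => (h₁.2 hy).add (h₂.2 hy)⟩
  obtain ⟨q₁, hq₁, rfl⟩ := h₁.1 hy
  obtain ⟨q₂, hq₂, rfl⟩ := h₂.1 hy
  exact ⟨fun k => q₁ k + q₂ k, fun k => (hq₁ k).add (hq₂ k), Finset.sum_add_distrib⟩

theorem const_mul (a : ℝ) (h : HasFrameOp n w ν f y c) :
    HasFrameOp n w ν (fun z => a * f z) y (a * c) := by
  refine ⟨fun hy => ?_, fun hy => (h.2 hy).const_mul a⟩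
  obtain ⟨q, hq, rfl⟩ := h.1 hy
  exact ⟨fun k => a * q k, fun k => (hq k).const_mul a, (Finset.mul_sum _ _ _).symm⟩

theorem sum {ι : Type*} (s : Finset ι) {F : ι → EuclideanSpace ℝ (Fin d) → ℝ} {C : ι → ℝ}
    (h : ∀ i ∈ s, HasFrameOp n w ν (F i) y (C i)) :
    HasFrameOp n w ν (fun z => ∑ i ∈ s, F i z) y (∑ i ∈ s, C i) := by
  classical
  induction s using Finset.induction_on with
  | empty => simpa using const (n := n) (w := w) (ν := ν) (y := y) 0
  | insert i s hi ih =>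
    simp only [Finset.sum_insert hi]
    exact (h i (by simp)).add (ih fun j hj => h j (by simp [hj]))

/-- At a local minimum in the half-space, neither the operator nor the oblique derivative can be
negative. -/
theorem nonneg_of_local_min (h : HasFrameOp n w ν f y c) (hν : ν n = 1) (hy : 0 ≤ y n) {r : ℝ}
    (hr : 0 < r) (hmin : ∀ z, 0 ≤ z n → dist z y < r → f y ≤ f z) : 0 ≤ c := by
  have hcoord : Continuous fun z : EuclideanSpace ℝ (Fin d) => z n := by fun_prop
  rcases hy.lt_or_eq with hpos | hzero
  · obtain ⟨q, hq, rfl⟩ := h.1 hpos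
    have hloc : IsLocalMin f y := by
      filter_upwards [Metric.ball_mem_nhds y hr,
        hcoord.continuousAt.eventually (lt_mem_nhds hpos)] with z hz hzn
      exact hmin z hzn.le hz
    exact Finset.sum_nonneg fun k _ => (hq k).nonneg_of_isLocalMin hloc
  · have hd := h.2 hzero.symm
    have hline : ContinuousAt (fun t : ℝ => y + t • ν) 0 := by fun_prop
    have hball : ∀ᶠ t : ℝ in nhds 0, dist (y + t • ν) y < r := by
      have : Metric.ball y r ∈ nhds (y + (0 : ℝ) • ν) := by simpa using Metric.ball_mem_nhds y hr
      exact hline.eventually this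
    have hslope := hd.tendsto_slope_zero_right
    refine ge_of_tendsto hslope ?_
    filter_upwards [self_mem_nhdsWithin, nhdsWithin_le_nhds hball] with t ht htr
    have ht' : (0 : ℝ) < t := ht
    have := hmin (y + t • ν) (by simp [← hzero, hν, ht'.le]) htr
    simp only [zero_add, zero_smul, add_zero, smul_eq_mul]
    exact mul_nonneg (inv_nonneg.2 ht'.le) (sub_nonneg.2 this)

end HasFrameOp

/-- Comparison principle: a continuous function on a compact set which is a strict supersolution
wherever it is negative is nonnegative. -/
theorem nonneg_of_strict_supersolution {d : ℕ} {n : Fin d} {Q : Set (EuclideanSpace ℝ (Fin d))}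
    (hQ : IsCompact Q) {f : EuclideanSpace ℝ (Fin d) → ℝ} (hf : ContinuousOn f Q)
    (h : ∀ y ∈ Q, f y < 0 → 0 ≤ y n ∧ (∃ r > 0, ∀ z, 0 ≤ z n → dist z y < r → z ∈ Q) ∧
      ∃ w ν c, ν n = 1 ∧ c < 0 ∧ HasFrameOp n w ν f y c) :
    ∀ y ∈ Q, 0 ≤ f y := by
  intro y₀ hy₀
  obtain ⟨y, hy, hmin⟩ := hQ.exists_isMinOn ⟨y₀, hy₀⟩ hf
  by_contra! hneg
  obtain ⟨hyn, ⟨r, hr, hrQ⟩, w, ν, c, hν, hc, hop⟩ := h y hy ((hmin hy₀).trans_lt hneg)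
  exact hc.not_ge (hop.nonneg_of_local_min hν hyn hr fun z hz hzr => hmin (hrQ z hz hzr))

/-- The homogeneous function `|z|^(-2β) + ε z_n |z|^(-2β-1)`. -/
def obliqueKernel {d : ℕ} (n : Fin d) (β ε : ℝ) (z : EuclideanSpace ℝ (Fin d)) : ℝ :=
  (‖z‖ ^ 2) ^ (-β) + ε * (z n * (‖z‖ ^ 2) ^ (-β - 1 / 2))

theorem hasDerivAt_rpow_quadratic {a b c : ℝ} (p t : ℝ) (h : 0 < a + 2 * b * t + c * t ^ 2) :
    HasDerivAt (fun t : ℝ => (a + 2 * b * t + c * t ^ 2) ^ p)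
      ((2 * b + 2 * c * t) * p * (a + 2 * b * t + c * t ^ 2) ^ (p - 1)) t := by
  refine HasDerivAt.rpow_const ?_ (Or.inl h.ne')
  have h1 : HasDerivAt (fun t : ℝ => 2 * b * t) (2 * b) t := by
    simpa using (hasDerivAt_id t).const_mul (2 * b)
  have h2 : HasDerivAt (fun t : ℝ => c * t ^ 2) (c * (2 * t)) t := by
    simpa using (hasDerivAt_pow 2 t).const_mul c
  have := (h1.const_add a).add h2
  exact this.congr_deriv (by ring)

section

variable {d : ℕ} (n : Fin d) (β ε : ℝ) (z w : EuclideanSpace ℝ (Fin d))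

theorem obliqueKernel_line (t : ℝ) :
    obliqueKernel n β ε (z + t • w) =
      (‖z‖ ^ 2 + 2 * inner ℝ z w * t + ‖w‖ ^ 2 * t ^ 2) ^ (-β) + ε * ((z n + w n * t) *
        (‖z‖ ^ 2 + 2 * inner ℝ z w * t + ‖w‖ ^ 2 * t ^ 2) ^ (-β - 1 / 2)) := by
  have : ‖z + t • w‖ ^ 2 = ‖z‖ ^ 2 + 2 * inner ℝ z w * t + ‖w‖ ^ 2 * t ^ 2 := by
    rw [norm_add_sq_real, norm_smul, inner_smul_right, mul_pow, Real.norm_eq_abs, sq_abs]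
    ring
  simp only [obliqueKernel, this, PiLp.add_apply, PiLp.smul_apply, smul_eq_mul]
  ring

theorem hasDerivAt_obliqueKernel_line (t : ℝ)
    (ht : 0 < ‖z‖ ^ 2 + 2 * inner ℝ z w * t + ‖w‖ ^ 2 * t ^ 2) :
    HasDerivAt (fun t : ℝ => obliqueKernel n β ε (z + t • w))
      ((2 * inner ℝ z w + 2 * ‖w‖ ^ 2 * t) * (-β) *
          (‖z‖ ^ 2 + 2 * inner ℝ z w * t + ‖w‖ ^ 2 * t ^ 2) ^ (-β - 1) +
        ε * (w n * (‖z‖ ^ 2 + 2 * inner ℝ z w * t + ‖w‖ ^ 2 * t ^ 2) ^ (-β - 1 / 2) +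
          (z n + w n * t) * ((2 * inner ℝ z w + 2 * ‖w‖ ^ 2 * t) * (-β - 1 / 2) *
          (‖z‖ ^ 2 + 2 * inner ℝ z w * t + ‖w‖ ^ 2 * t ^ 2) ^ (-β - 1 / 2 - 1)))) t := by
  simp only [obliqueKernel_line]
  have hlin : HasDerivAt (fun t : ℝ => z n + w n * t) (w n) t := by
    simpa using ((hasDerivAt_id t).const_mul (w n)).const_add (z n)
  exact (hasDerivAt_rpow_quadratic _ _ ht).add
    ((hlin.mul (hasDerivAt_rpow_quadratic _ _ ht)).const_mul ε)

variable {z}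

theorem hasDerivAt_obliqueKernel (hz : z ≠ 0) :
    HasDerivAt (fun t : ℝ => obliqueKernel n β ε (z + t • w))
      ((‖z‖ ^ 2) ^ (-β - 1 / 2) * (-2 * β * (inner ℝ z w / ‖z‖) +
        ε * (w n - (2 * β + 1) * (z n / ‖z‖) * (inner ℝ z w / ‖z‖)))) 0 := by
  have hr : 0 < ‖z‖ := norm_pos_iff.2 hz
  have hP : 0 < ‖z‖ ^ 2 := by positivity
  convert hasDerivAt_obliqueKernel_line n β ε z w 0 (by simpa using hP) using 1
  simp only [mul_zero, add_zero, ne_eq, OfNat.ofNat_ne_zero, not_false_eq_true, zero_pow]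
  have h1 : (‖z‖ ^ 2) ^ (-β - 1) = (‖z‖ ^ 2) ^ (-β - 1 / 2) / ‖z‖ := by
    rw [show -β - 1 = (-β - 1 / 2) - 1 / 2 by ring, Real.rpow_sub hP, ← Real.sqrt_eq_rpow,
      Real.sqrt_sq hr.le]
  have h2 : (‖z‖ ^ 2) ^ (-β - 1 / 2 - 1) = (‖z‖ ^ 2) ^ (-β - 1 / 2) / ‖z‖ ^ 2 := by
    rw [Real.rpow_sub_one hP.ne']
  rw [h1, h2]
  field_simp
  ring

theorem hasSecondDirDeriv_obliqueKernel (hz : z ≠ 0) :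
    HasSecondDirDeriv (obliqueKernel n β ε) z w
      ((‖z‖ ^ 2) ^ (-β - 1) * (4 * β * (β + 1) * (inner ℝ z w / ‖z‖) ^ 2 - 2 * β * ‖w‖ ^ 2 +
        ε * (-2 * (2 * β + 1) * w n * (inner ℝ z w / ‖z‖) +
          (2 * β + 1) * (2 * β + 3) * (z n / ‖z‖) * (inner ℝ z w / ‖z‖) ^ 2 -
          (2 * β + 1) * (z n / ‖z‖) * ‖w‖ ^ 2))) := by
  have hr : 0 < ‖z‖ := norm_pos_iff.2 hz
  have hP : 0 < ‖z‖ ^ 2 := by positivity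
  refine ⟨fun t => (2 * inner ℝ z w + 2 * ‖w‖ ^ 2 * t) * (-β) *
          (‖z‖ ^ 2 + 2 * inner ℝ z w * t + ‖w‖ ^ 2 * t ^ 2) ^ (-β - 1) +
        ε * (w n * (‖z‖ ^ 2 + 2 * inner ℝ z w * t + ‖w‖ ^ 2 * t ^ 2) ^ (-β - 1 / 2) +
          (z n + w n * t) * ((2 * inner ℝ z w + 2 * ‖w‖ ^ 2 * t) * (-β - 1 / 2) *
          (‖z‖ ^ 2 + 2 * inner ℝ z w * t + ‖w‖ ^ 2 * t ^ 2) ^ (-β - 1 / 2 - 1))), ?_, ?_⟩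
  · have hcont : ContinuousAt
        (fun t : ℝ => ‖z‖ ^ 2 + 2 * inner ℝ z w * t + ‖w‖ ^ 2 * t ^ 2) 0 := by fun_prop
    filter_upwards [hcont.eventually (lt_mem_nhds (by simpa using hP))] with t ht
    exact hasDerivAt_obliqueKernel_line n β ε z w t ht
  · have h0 : 0 < ‖z‖ ^ 2 + 2 * inner ℝ z w * 0 + ‖w‖ ^ 2 * (0 : ℝ) ^ 2 := by simpa using hP
    have hlin : HasDerivAt (fun t : ℝ => z n + w n * t) (w n) 0 := by
      simpa using ((hasDerivAt_id (0 : ℝ)).const_mul (w n)).const_add (z n)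
    have hlin2 : HasDerivAt (fun t : ℝ => 2 * inner ℝ z w + 2 * ‖w‖ ^ 2 * t) (2 * ‖w‖ ^ 2) 0 := by
      simpa using ((hasDerivAt_id (0 : ℝ)).const_mul (2 * ‖w‖ ^ 2)).const_add (2 * inner ℝ z w)
    have hmain := ((hlin2.mul_const (-β)).mul (hasDerivAt_rpow_quadratic (-β - 1) _ h0)).add
      ((((hasDerivAt_rpow_quadratic (-β - 1 / 2) _ h0).const_mul (w n)).add
        (hlin.mul ((hlin2.mul_const (-β - 1 / 2)).mul
          (hasDerivAt_rpow_quadratic (-β - 1 / 2 - 1) _ h0)))).const_mul ε)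
    refine hmain.congr_deriv ?_
    simp only [Pi.mul_apply, mul_zero, add_zero, ne_eq, OfNat.ofNat_ne_zero, not_false_eq_true, zero_pow]
    have h1 : (‖z‖ ^ 2) ^ (-β - 1 - 1) = (‖z‖ ^ 2) ^ (-β - 1) / ‖z‖ ^ 2 := by
      rw [Real.rpow_sub_one hP.ne']
    have h2 : (‖z‖ ^ 2) ^ (-β - 1 / 2 - 1) = (‖z‖ ^ 2) ^ (-β - 1) / ‖z‖ := by
      rw [show -β - 1 / 2 - 1 = (-β - 1) - 1 / 2 by ring, Real.rpow_sub hP, ← Real.sqrt_eq_rpow,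
        Real.sqrt_sq hr.le]
    have h3 : (‖z‖ ^ 2) ^ (-β - 1 / 2 - 1 - 1) = (‖z‖ ^ 2) ^ (-β - 1) / ‖z‖ / ‖z‖ ^ 2 := by
      rw [Real.rpow_sub_one hP.ne', h2]
    rw [h1, h2, h3]
    field_simp
    ring

end

/-- The vectors `w k` and `ν` are `η`-close to the standard frame and to the inner normal of the
half-space `{y n ≥ 0}`. -/
structure IsNearFrame {d : ℕ} (n : Fin d) (η : ℝ) (w : Fin d → EuclideanSpace ℝ (Fin d))
    (ν : EuclideanSpace ℝ (Fin d)) : Prop where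
  frame : ∀ k, ‖w k - EuclideanSpace.single k 1‖ ≤ η
  normal : ν n = 1
  normal_near : ‖ν - EuclideanSpace.single n 1‖ ≤ η

theorem IsNearFrame.mono {d : ℕ} {n : Fin d} {η η' : ℝ} {w : Fin d → EuclideanSpace ℝ (Fin d)}
    {ν : EuclideanSpace ℝ (Fin d)} (h : IsNearFrame n η w ν) (hη : η ≤ η') :
    IsNearFrame n η' w ν :=
  ⟨fun k => (h.frame k).trans hη, h.normal, h.normal_near.trans hη⟩

section

variable {d : ℕ} {n : Fin d} {η : ℝ} {w : Fin d → EuclideanSpace ℝ (Fin d)}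
  {ν z : EuclideanSpace ℝ (Fin d)}

theorem abs_inner_div_norm_le (z x : EuclideanSpace ℝ (Fin d)) :
    |inner ℝ z x / ‖z‖| ≤ ‖x‖ := by
  rcases eq_or_ne z 0 with rfl | hz
  · simp
  · have hr : 0 < ‖z‖ := norm_pos_iff.2 hz
    rw [abs_div, abs_norm, div_le_iff₀ hr, mul_comm]
    exact abs_real_inner_le_norm z x

theorem abs_apply_div_norm_le (z : EuclideanSpace ℝ (Fin d)) (k : Fin d) : |z k / ‖z‖| ≤ 1 := by
  rw [abs_div, abs_norm]
  exact div_le_one_of_le₀ (PiLp.norm_apply_le z k) (norm_nonneg _)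

theorem abs_inner_div_norm_sub_le (z x : EuclideanSpace ℝ (Fin d)) (k : Fin d) :
    |inner ℝ z x / ‖z‖ - z k / ‖z‖| ≤ ‖x - EuclideanSpace.single k 1‖ := by
  have : inner ℝ z x / ‖z‖ - z k / ‖z‖ = inner ℝ z (x - EuclideanSpace.single k 1) / ‖z‖ := by
    rw [inner_sub_right, EuclideanSpace.inner_single_right]
    simp [sub_div]
  rw [this]
  exact abs_inner_div_norm_le _ _

theorem exists_frame_sum_obliqueKernel {β : ℝ} (hβ : 0 < β) (ε : ℝ) (hη : η ≤ 1)
    (hw : IsNearFrame n η w ν) (hz : z ≠ 0) :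
    ∃ (q : Fin d → ℝ) (s : ℝ), (∀ k, HasSecondDirDeriv (obliqueKernel n β ε) z (w k) (q k)) ∧
      ∑ k, q k = (‖z‖ ^ 2) ^ (-β - 1) * s ∧
      |s - 2 * β * (2 * β + 2 - d)| ≤
        d * (3 * (4 * β * (β + 1) + 2 * β) + 8 * (2 * β + 1) * (β + 3)) * (η + |ε|) := by
  have hr : 0 < ‖z‖ := norm_pos_iff.2 hz
  set b : Fin d → ℝ := fun k => inner ℝ z (w k) / ‖z‖ with hb
  set S : Fin d → ℝ := fun k => 4 * β * (β + 1) * (b k) ^ 2 - 2 * β * ‖w k‖ ^ 2 +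
        ε * (-2 * (2 * β + 1) * w k n * b k +
          (2 * β + 1) * (2 * β + 3) * (z n / ‖z‖) * (b k) ^ 2 -
          (2 * β + 1) * (z n / ‖z‖) * ‖w k‖ ^ 2) with hS
  refine ⟨fun k => (‖z‖ ^ 2) ^ (-β - 1) * S k, ∑ k, S k,
    fun k => hasSecondDirDeriv_obliqueKernel n β ε (w k) hz, (Finset.mul_sum _ _ _).symm, ?_⟩
  have hsum : ∑ k, (z k / ‖z‖) ^ 2 = 1 := by
    simp only [div_pow]
    rw [← Finset.sum_div, EuclideanSpace.norm_sq_eq]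
    simp only [Real.norm_eq_abs, sq_abs]
    refine div_self ?_
    have := EuclideanSpace.norm_sq_eq z
    simp only [Real.norm_eq_abs, sq_abs] at this
    rw [← this]; positivity
  have hsplit : ∑ k, S k - 2 * β * (2 * β + 2 - d) =
      ∑ k, (S k - (4 * β * (β + 1) * (z k / ‖z‖) ^ 2 - 2 * β)) := by
    rw [Finset.sum_sub_distrib, Finset.sum_sub_distrib, ← Finset.mul_sum, hsum]
    simp
    ring
  rw [hsplit]
  have hη0 : 0 ≤ η := (norm_nonneg _).trans (hw.frame n)
  have key : ∀ k, |S k - (4 * β * (β + 1) * (z k / ‖z‖) ^ 2 - 2 * β)| ≤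
      (3 * (4 * β * (β + 1) + 2 * β) + 8 * (2 * β + 1) * (β + 3)) * (η + |ε|) := by
    intro k
    have h1 : ‖(EuclideanSpace.single k 1 : EuclideanSpace ℝ (Fin d))‖ = 1 := by simp
    have hwk : |‖w k‖ - 1| ≤ η := by
      rw [← h1]; exact (abs_norm_sub_norm_le _ _).trans (hw.frame k)
    have hwk2 : ‖w k‖ ≤ 2 := by linarith [(abs_le.1 hwk).2]
    have hbk : |b k| ≤ 2 := (abs_inner_div_norm_le z (w k)).trans hwk2
    have hzk := abs_apply_div_norm_le z k
    have hzn := abs_apply_div_norm_le z n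
    have hwn : |w k n| ≤ 2 := (PiLp.norm_apply_le (w k) n).trans hwk2
    have hdiff : |b k - z k / ‖z‖| ≤ η := (abs_inner_div_norm_sub_le z (w k) k).trans (hw.frame k)
    have e1 : |b k ^ 2 - (z k / ‖z‖) ^ 2| ≤ 3 * η := by
      rw [sq_sub_sq, abs_mul]
      have : |b k + z k / ‖z‖| ≤ 3 := (abs_add_le _ _).trans (by linarith)
      exact mul_le_mul this hdiff (abs_nonneg _) (by norm_num)
    have e2 : |‖w k‖ ^ 2 - 1| ≤ 3 * η := by
      rw [show ‖w k‖ ^ 2 - 1 = (‖w k‖ + 1) * (‖w k‖ - 1) by ring, abs_mul]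
      have : |‖w k‖ + 1| ≤ 3 := by rw [abs_of_nonneg (by positivity)]; linarith
      exact mul_le_mul this hwk (abs_nonneg _) (by norm_num)
    have hbsq : |b k ^ 2| ≤ 4 := by rw [abs_pow]; nlinarith [abs_nonneg (b k)]
    have hwsq : |‖w k‖ ^ 2| ≤ 4 := by rw [abs_pow, abs_norm]; nlinarith [norm_nonneg (w k)]
    have e3 : |w k n * b k| ≤ 4 := by
      rw [abs_mul]; nlinarith [abs_nonneg (b k), abs_nonneg (w k n)]
    have e4 : |z n / ‖z‖ * b k ^ 2| ≤ 4 := by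
      rw [abs_mul]; nlinarith [abs_nonneg (b k ^ 2), abs_nonneg (z n / ‖z‖)]
    have e5 : |z n / ‖z‖ * ‖w k‖ ^ 2| ≤ 4 := by
      rw [abs_mul]; nlinarith [abs_nonneg (‖w k‖ ^ 2), abs_nonneg (z n / ‖z‖)]
    have expand : S k - (4 * β * (β + 1) * (z k / ‖z‖) ^ 2 - 2 * β) =
        4 * β * (β + 1) * (b k ^ 2 - (z k / ‖z‖) ^ 2) + (-(2 * β)) * (‖w k‖ ^ 2 - 1) +
        ε * ((-2 * (2 * β + 1)) * (w k n * b k) +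
          (2 * β + 1) * (2 * β + 3) * (z n / ‖z‖ * b k ^ 2) +
          (-(2 * β + 1)) * (z n / ‖z‖ * ‖w k‖ ^ 2)) := by
      simp only [hS]; ring
    have hbr : |(-2 * (2 * β + 1)) * (w k n * b k) +
          (2 * β + 1) * (2 * β + 3) * (z n / ‖z‖ * b k ^ 2) +
          (-(2 * β + 1)) * (z n / ‖z‖ * ‖w k‖ ^ 2)| ≤ 8 * (2 * β + 1) * (β + 3) := by
      refine (abs_add_three _ _ _).trans ?_
      rw [abs_mul (-2 * (2 * β + 1)), abs_mul ((2 * β + 1) * (2 * β + 3)), abs_mul (-(2 * β + 1)),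
        show -2 * (2 * β + 1) = -(2 * (2 * β + 1)) by ring, abs_neg, abs_neg,
        abs_of_pos (show 0 < 2 * (2 * β + 1) by linarith),
        abs_of_pos (show 0 < 2 * β + 1 by linarith),
        abs_of_pos (show 0 < (2 * β + 1) * (2 * β + 3) by positivity)]
      have g1 : 2 * (2 * β + 1) * |w k n * b k| ≤ 2 * (2 * β + 1) * 4 := by gcongr
      have g2 : (2 * β + 1) * (2 * β + 3) * |z n / ‖z‖ * b k ^ 2| ≤
        (2 * β + 1) * (2 * β + 3) * 4 := by gcongr
      have g3 : (2 * β + 1) * |z n / ‖z‖ * ‖w k‖ ^ 2| ≤ (2 * β + 1) * 4 := by gcongr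
      nlinarith
    rw [expand]
    refine (abs_add_three _ _ _).trans ?_
    rw [abs_mul (4 * β * (β + 1)), abs_mul (-(2 * β)), abs_mul ε, abs_neg, abs_of_pos (show 0 < 2 * β by linarith),
      abs_of_pos (show 0 < 4 * β * (β + 1) by positivity)]
    have g1 : 4 * β * (β + 1) * |b k ^ 2 - (z k / ‖z‖) ^ 2| ≤ 4 * β * (β + 1) * (3 * η) := by gcongr
    have g2 : 2 * β * |‖w k‖ ^ 2 - 1| ≤ 2 * β * (3 * η) := by gcongr
    have g3 := mul_le_mul_of_nonneg_left hbr (abs_nonneg ε)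
    have g4 : 0 ≤ 8 * (2 * β + 1) * (β + 3) * η := by positivity
    have g5 : 0 ≤ 3 * (4 * β * (β + 1) + 2 * β) * |ε| := by positivity
    refine (add_le_add_three g1 g2 g3).trans ?_
    linarith
  refine (Finset.abs_sum_le_sum_abs _ _).trans ((Finset.sum_le_sum fun k _ => key k).trans ?_)
  simp only [Finset.sum_const, Finset.card_univ, Fintype.card_fin, nsmul_eq_mul]
  exact (mul_assoc _ _ _).ge

end

section

variable {d : ℕ} (n : Fin d) {β : ℝ} (ε : ℝ) {z : EuclideanSpace ℝ (Fin d)}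

theorem sq_norm_rpow (β : ℝ) (z : EuclideanSpace ℝ (Fin d)) :
    (‖z‖ ^ 2) ^ (-β) = ‖z‖ ^ (-(2 * β)) := by
  rw [← Real.rpow_natCast, ← Real.rpow_mul (norm_nonneg z)]
  congr 1
  push_cast
  ring

theorem abs_apply_mul_sq_norm_rpow_le (hz : z ≠ 0) :
    |z n * (‖z‖ ^ 2) ^ (-β - 1 / 2)| ≤ ‖z‖ ^ (-(2 * β)) := by
  have hr : 0 < ‖z‖ := norm_pos_iff.2 hz
  have hP : 0 < ‖z‖ ^ 2 := by positivity
  rw [Real.rpow_sub hP, ← Real.sqrt_eq_rpow, Real.sqrt_sq hr.le, sq_norm_rpow, abs_mul, abs_div,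
    abs_norm, abs_of_pos (Real.rpow_pos_of_pos hr _)]
  rw [mul_div_assoc', div_le_iff₀ hr, mul_comm]
  exact mul_le_mul_of_nonneg_left (PiLp.norm_apply_le z n) (Real.rpow_nonneg hr.le _)

theorem obliqueKernel_le (hz : z ≠ 0) :
    obliqueKernel n β ε z ≤ (1 + |ε|) * ‖z‖ ^ (-(2 * β)) := by
  have h := mul_le_mul_of_nonneg_left (abs_apply_mul_sq_norm_rpow_le n (β := β) hz) (abs_nonneg ε)
  rw [← abs_mul] at h
  rw [obliqueKernel, sq_norm_rpow]
  linarith [le_abs_self (ε * (z n * (‖z‖ ^ 2) ^ (-β - 1 / 2)))]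

theorem le_obliqueKernel (hz : z ≠ 0) :
    (1 - |ε|) * ‖z‖ ^ (-(2 * β)) ≤ obliqueKernel n β ε z := by
  have h := mul_le_mul_of_nonneg_left (abs_apply_mul_sq_norm_rpow_le n (β := β) hz) (abs_nonneg ε)
  rw [← abs_mul] at h
  rw [obliqueKernel, sq_norm_rpow]
  linarith [neg_abs_le (ε * (z n * (‖z‖ ^ 2) ^ (-β - 1 / 2)))]

theorem obliqueKernel_neg_le (hε : 0 ≤ ε) (hzn : 0 ≤ z n) :
    obliqueKernel n β (-ε) z ≤ ‖z‖ ^ (-(2 * β)) := by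
  rw [obliqueKernel, sq_norm_rpow]
  have : 0 ≤ ε * (z n * (‖z‖ ^ 2) ^ (-β - 1 / 2)) := by positivity
  linarith

theorem continuousAt_obliqueKernel (hz : z ≠ 0) : ContinuousAt (obliqueKernel n β ε) z := by
  have hP : ‖z‖ ^ 2 ≠ 0 := pow_ne_zero _ (norm_ne_zero_iff.2 hz)
  have hnorm : ContinuousAt (fun z : EuclideanSpace ℝ (Fin d) => ‖z‖ ^ 2) z := by fun_prop
  have hcoord : ContinuousAt (fun z : EuclideanSpace ℝ (Fin d) => z n) z := by fun_prop
  exact (hnorm.rpow_const (Or.inl hP)).add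
    ((hcoord.mul (hnorm.rpow_const (Or.inl hP))).const_mul ε)

end

/-- For small `ε` and nearly standard frames, the kernel of degree `-(d - 1)` with pole in the
closed half-space is a strict subsolution away from its pole. -/
theorem exists_obliqueKernel_subsolution {d : ℕ} (hd : 2 ≤ d) :
    ∃ ε > 0, ε ≤ 1 / 2 ∧ ∃ η > 0, ∀ (n : Fin d) w ν, IsNearFrame n η w ν →
      ∀ x y : EuclideanSpace ℝ (Fin d), y ≠ x → 0 ≤ x n →
        ∃ c > 0, HasFrameOp n w ν (fun z => obliqueKernel n (((d : ℝ) - 1) / 2) ε (z - x)) y c := by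
  have hd' : (2 : ℝ) ≤ d := by exact_mod_cast hd
  set β : ℝ := ((d : ℝ) - 1) / 2 with hβdef
  have hβ : 0 < β := by rw [hβdef]; linarith
  set K : ℝ := d * (3 * (4 * β * (β + 1) + 2 * β) + 8 * (2 * β + 1) * (β + 3)) with hK
  have hKpos : 0 < K := by positivity
  set ε : ℝ := min (1 / 2) (min (β / (2 * K)) (2 * β / (2 * β + 1))) with hε
  have hεpos : 0 < ε := by positivity
  have hε1 : ε ≤ 1 / 2 := min_le_left _ _
  have hε2 : ε * (2 * K) ≤ β :=
    (le_div_iff₀ (by positivity)).1 ((min_le_right _ _).trans (min_le_left _ _))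
  have hε3 : ε * (2 * β + 1) ≤ 2 * β :=
    (le_div_iff₀ (by positivity)).1 ((min_le_right _ _).trans (min_le_right _ _))
  set η : ℝ := min 1 (min (β / (2 * K)) (ε / (2 * (4 * β)))) with hη
  have hηpos : 0 < η := by positivity
  have hη1 : η ≤ 1 := min_le_left _ _
  have hη2 : η * (2 * K) ≤ β :=
    (le_div_iff₀ (by positivity)).1 ((min_le_right _ _).trans (min_le_left _ _))
  have hη3 : η * (2 * (4 * β)) ≤ ε :=
    (le_div_iff₀ (by positivity)).1 ((min_le_right _ _).trans (min_le_right _ _))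
  refine ⟨ε, hεpos, hε1, η, hηpos, fun n w ν hw x y hyx hx => ?_⟩
  have hz : y - x ≠ 0 := sub_ne_zero.2 hyx
  have hr : 0 < ‖y - x‖ := norm_pos_iff.2 hz
  obtain ⟨q, s, hq, hqs, hs⟩ := exists_frame_sum_obliqueKernel hβ ε hη1 hw hz
  have hspos : 0 < s := by
    rw [abs_of_pos hεpos, show 2 * β + 2 - (d : ℝ) = 1 by rw [hβdef]; ring] at hs
    have := (abs_le.1 hs).1
    nlinarith
  have hint : 0 < ∑ k, q k := by rw [hqs]; positivity
  set b : ℝ := inner ℝ (y - x) ν / ‖y - x‖ with hb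
  set t : ℝ := (y - x) n / ‖y - x‖ with ht
  have hbd := hasDerivAt_obliqueKernel n β ε ν hz
  rcases eq_or_ne (y n) 0 with hyn | hyn
  · simp only [sub_add_eq_add_sub] at hbd
    refine ⟨_, ?_, fun h => absurd h (by simp [hyn]), fun _ => hbd⟩
    · refine mul_pos (Real.rpow_pos_of_pos (by positivity) _) ?_
      rw [← hb, ← ht, hw.normal]
      have ht0 : t ≤ 0 := by
        rw [ht]
        refine div_nonpos_of_nonpos_of_nonneg ?_ hr.le
        simp only [PiLp.sub_apply, hyn]
        linarith
      have ht1 : |t| ≤ 1 := abs_apply_div_norm_le _ _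
      have hbt : |b - t| ≤ η := (abs_inner_div_norm_sub_le _ _ _).trans hw.normal_near
      have ht2 := (abs_le.1 ht1).1
      obtain ⟨hbt1, hbt2⟩ := abs_le.1 hbt
      obtain ⟨θ, hθ⟩ : ∃ θ, b = t + θ := ⟨b - t, by ring⟩
      rw [hθ]
      have hθ1 : θ ≤ η := by linarith
      have hθ2 : -η ≤ θ := by linarith
      obtain ⟨T, hT⟩ : ∃ T, t = -T := ⟨-t, by ring⟩
      rw [hT]
      have hT0 : 0 ≤ T := by linarith
      have hT1 : T ≤ 1 := by linarith
      have m1 : β * θ ≤ β * η := by gcongr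
      have m2 : -η ≤ T * θ := by nlinarith
      have m3 : ε * (2 * β + 1) * (T * T) ≤ 2 * β * T := by
        have : T * T ≤ T := by nlinarith
        calc ε * (2 * β + 1) * (T * T) ≤ (2 * β) * (T * T) := by gcongr
          _ ≤ 2 * β * T := by gcongr
      have m4 : -(2 * β * η) ≤ ε * (2 * β + 1) * (T * θ) := by
        have a1 : ε * (2 * β + 1) * (-η) ≤ ε * (2 * β + 1) * (T * θ) := by gcongr
        have a2 : ε * (2 * β + 1) * η ≤ 2 * β * η := by gcongr
        linarith
      linarith
  · exact ⟨_, hint, fun _ => ⟨q, fun k => (hq k).comp_sub x, rfl⟩, fun h => absurd h hyn⟩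

/-- For `0 < α < d - 2`, small `ε` and nearly standard frames, the kernel of degree `-α` is a strict
supersolution away from the origin. -/
theorem exists_obliqueKernel_supersolution {d : ℕ} {α : ℝ} (hα : 0 < α) (hαd : α < (d : ℝ) - 2) :
    ∃ ε > 0, ε ≤ 1 / 10 ∧ ∃ η > 0, ∀ (n : Fin d) w ν, IsNearFrame n η w ν →
      ∀ y : EuclideanSpace ℝ (Fin d), y ≠ 0 →
        ∃ c < 0, HasFrameOp n w ν (obliqueKernel n (α / 2) (-ε)) y c := by
  set β : ℝ := α / 2 with hβdef
  have hβ : 0 < β := by rw [hβdef]; linarith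
  have hd : (0 : ℝ) < d := by linarith
  set K : ℝ := d * (3 * (4 * β * (β + 1) + 2 * β) + 8 * (2 * β + 1) * (β + 3)) with hK
  have hKpos : 0 < K := by positivity
  set σ : ℝ := 2 * β * ((d : ℝ) - 2 - 2 * β) with hσ
  have hσpos : 0 < σ := mul_pos (by linarith) (by rw [hβdef]; linarith)
  set ε : ℝ := min (1 / 10) (σ / (4 * K)) with hε
  have hεpos : 0 < ε := by positivity
  have hε1 : ε ≤ 1 / 10 := min_le_left _ _
  have hε2 : ε * (4 * K) ≤ σ := (le_div_iff₀ (by positivity)).1 (min_le_right _ _)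
  set η : ℝ := min 1 (min (σ / (4 * K)) (ε / (4 * β))) with hη
  have hηpos : 0 < η := by positivity
  have hη1 : η ≤ 1 := min_le_left _ _
  have hη2 : η * (4 * K) ≤ σ :=
    (le_div_iff₀ (by positivity)).1 ((min_le_right _ _).trans (min_le_left _ _))
  have hη3 : η * (4 * β) ≤ ε :=
    (le_div_iff₀ (by positivity)).1 ((min_le_right _ _).trans (min_le_right _ _))
  refine ⟨ε, hεpos, hε1, η, hηpos, fun n w ν hw y hy => ?_⟩
  have hr : 0 < ‖y‖ := norm_pos_iff.2 hy
  obtain ⟨q, s, hq, hqs, hs⟩ := exists_frame_sum_obliqueKernel hβ (-ε) hη1 hw hy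
  have hsneg : s < 0 := by
    rw [abs_neg, abs_of_pos hεpos,
      show 2 * β * (2 * β + 2 - (d : ℝ)) = -σ by rw [hσ]; ring] at hs
    have := (abs_le.1 hs).2
    nlinarith
  have hint : ∑ k, q k < 0 := by
    rw [hqs]; exact mul_neg_of_pos_of_neg (Real.rpow_pos_of_pos (by positivity) _) hsneg
  rcases eq_or_ne (y n) 0 with hyn | hyn
  · refine ⟨_, ?_, fun h => absurd h (by simp [hyn]),
      fun _ => hasDerivAt_obliqueKernel n β (-ε) ν hy⟩
    refine mul_neg_of_pos_of_neg (Real.rpow_pos_of_pos (by positivity) _) ?_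
    have hbt : |inner ℝ y ν / ‖y‖ - y n / ‖y‖| ≤ η :=
      (abs_inner_div_norm_sub_le _ _ _).trans hw.normal_near
    rw [hyn, zero_div, sub_zero] at hbt
    rw [hw.normal, hyn, zero_div]
    have := (abs_le.1 hbt).1
    nlinarith
  · exact ⟨_, hint, fun _ => ⟨q, hq, rfl⟩, fun h => absurd h hyn⟩

/-- `u` solves, on `U`, some linear equation whose frames are close to the standard one, and is
`1`-Lipschitz along segments contained in `U`. -/
structure IsFrameSol {d : ℕ} (n : Fin d) (η : ℝ) (U : Set (EuclideanSpace ℝ (Fin d)))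
    (u : EuclideanSpace ℝ (Fin d) → ℝ) : Prop where
  cont : ContinuousOn u U
  op : ∀ y ∈ U, ∃ w ν, IsNearFrame n η w ν ∧ HasFrameOp n w ν u y 0
  lip : ∀ y ∈ U, ∀ z ∈ U, segment ℝ y z ⊆ U → |u y - u z| ≤ dist y z

namespace IsFrameSol

variable {d : ℕ} {n : Fin d} {η : ℝ} {U V : Set (EuclideanSpace ℝ (Fin d))}
    {u : EuclideanSpace ℝ (Fin d) → ℝ}

theorem mono (h : IsFrameSol n η U u) (hVU : V ⊆ U) : IsFrameSol n η V u :=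
  ⟨h.cont.mono hVU, fun y hy => h.op y (hVU hy),
    fun y hy z hz hyz => h.lip y (hVU hy) z (hVU hz) (hyz.trans hVU)⟩

theorem add_const (h : IsFrameSol n η U u) (c : ℝ) : IsFrameSol n η U fun y => u y + c := by
  refine ⟨h.cont.add continuousOn_const, fun y hy => ?_, fun y hy z hz hyz => ?_⟩
  · obtain ⟨w, ν, hw, ho⟩ := h.op y hy
    exact ⟨w, ν, hw, by simpa using ho.add (.const c)⟩
  · simpa using h.lip y hy z hz hyz

theorem neg (h : IsFrameSol n η U u) : IsFrameSol n η U fun y => -u y := by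
  refine ⟨h.cont.neg, fun y hy => ?_, fun y hy z hz hyz => ?_⟩
  · obtain ⟨w, ν, hw, ho⟩ := h.op y hy
    exact ⟨w, ν, hw, by simpa using ho.const_mul (-1)⟩
  · rw [neg_sub_neg, abs_sub_comm]
    exact h.lip y hy z hz hyz

end IsFrameSol

theorem HasSecondDirDeriv.of_contDiffAt {E : Type*} [NormedAddCommGroup E] [NormedSpace ℝ E]
    {f : E → ℝ} {y : E} (hf : ContDiffAt ℝ 2 f y) (w : E) :
    HasSecondDirDeriv f y w (fderiv ℝ (fderiv ℝ f) y w w) := by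
  have hline : ∀ t : ℝ, HasDerivAt (fun t : ℝ => y + t • w) w t := fun t => by
    simpa using ((hasDerivAt_id t).smul_const w).const_add y
  have hline0 : Tendsto (fun t : ℝ => y + t • w) (nhds 0) (nhds y) := by
    have : ContinuousAt (fun t : ℝ => y + t • w) 0 := (hline 0).continuousAt
    simpa [ContinuousAt] using this
  refine ⟨fun t => fderiv ℝ f (y + t • w) w, ?_, ?_⟩
  · have hd : ∀ᶠ z in nhds y, DifferentiableAt ℝ f z := by
      filter_upwards [hf.eventually (by simp)] with z hz using hz.differentiableAt (by simp)
    filter_upwards [hline0.eventually hd] with t ht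
    exact ht.hasFDerivAt.comp_hasDerivAt t (hline t)
  · have h1 : DifferentiableAt ℝ (fderiv ℝ f) y :=
      (hf.fderiv_right (m := 1) (by norm_num)).differentiableAt (by simp)
    have h2 : HasFDerivAt (fderiv ℝ f) (fderiv ℝ (fderiv ℝ f) y) (y + (0 : ℝ) • w) := by
      simpa using h1.hasFDerivAt
    have h3 := h2.comp_hasDerivAt (0 : ℝ) (hline 0)
    have h4 := h3.clm_apply (hasDerivAt_const (0 : ℝ) w)
    simpa using h4

section

variable {d : ℕ} {hd : 0 < d} {v : EuclideanSpace ℝ (Fin d) → ℝ} {y : EuclideanSpace ℝ (Fin d)}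

theorem hessC_eq (hv : ContDiffAt ℝ 2 v y) (i j : Fin d) :
    hessC d v y i j =
      fderiv ℝ (fderiv ℝ v) y (EuclideanSpace.single j 1) (EuclideanSpace.single i 1) := by
  have h1 : DifferentiableAt ℝ (fderiv ℝ v) y :=
    (hv.fderiv_right (m := 1) (by norm_num)).differentiableAt (by simp)
  rw [hessC, fderiv_clm_apply h1 (differentiableAt_const _)]
  simp

theorem abs_gradC_le {η : ℝ} (h : ‖fderiv ℝ v y‖ ≤ η) (i : Fin d) : |gradC d v y i| ≤ η := by
  have := (fderiv ℝ v y).le_of_opNorm_le h (EuclideanSpace.single i 1)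
  simpa [gradC] using this

theorem tangSq_nonneg (p : Fin d → ℝ) : 0 ≤ tangSq d hd p :=
  Finset.sum_nonneg fun m _ => by split_ifs <;> positivity

/-- The frame `w` with `A(p) = ∑ k, w k ⊗ w k`. -/
def hodFrame (d : ℕ) (hd : 0 < d) (p : Fin d → ℝ) (k : Fin d) : EuclideanSpace ℝ (Fin d) :=
  if k = lastIdx d hd then (1 + p (lastIdx d hd))⁻¹ • EuclideanSpace.single k 1
  else EuclideanSpace.single k 1 +
    (p k / (1 + p (lastIdx d hd))) • EuclideanSpace.single (lastIdx d hd) 1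

/-- The direction `ν` with `p_d - N(p') = ⟨ν, p⟩`. -/
def hodNormal (d : ℕ) (hd : 0 < d) (p : Fin d → ℝ) : EuclideanSpace ℝ (Fin d) :=
  EuclideanSpace.single (lastIdx d hd) 1 - (√(1 + tangSq d hd p) + 1)⁻¹ •
    ∑ m, if m = lastIdx d hd then 0 else p m • EuclideanSpace.single m (1 : ℝ)

theorem tangSq_eq (p : Fin d → ℝ) :
    tangSq d hd p = ∑ m ∈ Finset.univ.erase (lastIdx d hd), p m ^ 2 := by
  rw [tangSq, ← Finset.sum_erase_add _ _ (Finset.mem_univ (lastIdx d hd)), if_pos rfl, add_zero]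
  exact Finset.sum_congr rfl fun m hm => if_neg (Finset.ne_of_mem_erase hm)

theorem sum_hodFrame (p : Fin d → ℝ)
    (B : EuclideanSpace ℝ (Fin d) →L[ℝ] EuclideanSpace ℝ (Fin d) →L[ℝ] ℝ) :
    ∑ k, B (hodFrame d hd p k) (hodFrame d hd p k) =
      ∑ i, ∑ j, hodA d hd p i j * B (EuclideanSpace.single j 1) (EuclideanSpace.single i 1) := by
  set n := lastIdx d hd with hn
  set e : Fin d → EuclideanSpace ℝ (Fin d) := fun i => EuclideanSpace.single i 1 with he
  set q : Fin d → ℝ := fun k => p k / (1 + p n) with hq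
  have hsplit : ∀ f : Fin d → ℝ, ∑ k, f k = ∑ k ∈ Finset.univ.erase n, f k + f n := fun f =>
    (Finset.sum_erase_add _ _ (Finset.mem_univ n)).symm
  have hrow : ∀ i ≠ n, ∑ j, hodA d hd p i j * B (e j) (e i) = B (e i) (e i) + q i * B (e n) (e i) := by
    intro i hi
    have : ∀ j, hodA d hd p i j * B (e j) (e i) =
        (if j = i then B (e i) (e i) else 0) + if j = n then q i * B (e n) (e i) else 0 := by
      intro j
      rcases eq_or_ne j n with rfl | hj
      · simp [hodA, ← hn, hi, hq, Ne.symm hi]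
      · rcases eq_or_ne j i with rfl | hji
        · simp [hodA, ← hn, hi]
        · simp [hodA, ← hn, hi, hj, hji, Ne.symm hji]
    simp [this, Finset.sum_add_distrib]
  have hlast : ∑ j, hodA d hd p n j * B (e j) (e n) =
      ∑ j ∈ Finset.univ.erase n, q j * B (e j) (e n) +
        (1 + tangSq d hd p) / (1 + p n) ^ 2 * B (e n) (e n) := by
    rw [hsplit]
    congr 1
    · refine Finset.sum_congr rfl fun j hj => ?_
      have hj' := Finset.ne_of_mem_erase hj
      simp [hodA, ← hn, hj', hq]
    · simp [hodA, ← hn]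
  have hframe : ∀ k ≠ n, B (hodFrame d hd p k) (hodFrame d hd p k) =
      (B (e k) (e k) + q k * B (e n) (e k)) + q k * B (e k) (e n) +
        p k ^ 2 * (B (e n) (e n) / (1 + p n) ^ 2) := by
    intro k hk
    simp [hodFrame, ← hn, hk, he, hq]
    rw [div_eq_mul_inv _ ((1 + p n) ^ 2), ← inv_pow]
    ring
  have hframe_last : B (hodFrame d hd p n) (hodFrame d hd p n) =
      B (e n) (e n) / (1 + p n) ^ 2 := by
    simp only [hodFrame, ← hn, if_true, map_smul, _root_.smul_apply, smul_eq_mul, he]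
    rw [div_eq_mul_inv, ← inv_pow]
    ring
  change ∑ k, B (hodFrame d hd p k) (hodFrame d hd p k) = ∑ i, ∑ j, hodA d hd p i j * B (e j) (e i)
  rw [hsplit, hsplit fun i => ∑ j, hodA d hd p i j * B (e j) (e i), hlast, hframe_last,
    Finset.sum_congr rfl fun k hk => hframe k (Finset.ne_of_mem_erase hk),
    Finset.sum_congr rfl fun i hi => hrow i (Finset.ne_of_mem_erase hi), Finset.sum_add_distrib,
    Finset.sum_add_distrib, ← Finset.sum_mul, tangSq_eq]
  ring

theorem isNearFrame_hodFrame {η : ℝ} (hη : η ≤ 1 / 2) {p : Fin d → ℝ} (hp : ∀ i, |p i| ≤ η) :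
    IsNearFrame (lastIdx d hd) ((d + 2) * η) (hodFrame d hd p) (hodNormal d hd p) := by
  set n := lastIdx d hd with hn
  have hη0 : 0 ≤ η := (abs_nonneg _).trans (hp n)
  have hdη : 0 ≤ d * η := by positivity
  have hpn : 1 / 2 ≤ 1 + p n := by linarith [(abs_le.1 (hp n)).1]
  have hpn' : (0 : ℝ) < 1 + p n := by linarith
  refine ⟨fun k => ?_, ?_, ?_⟩
  · by_cases hk : k = n
    · have : hodFrame d hd p k - EuclideanSpace.single k 1 =
          (-(p n) / (1 + p n)) • EuclideanSpace.single k (1 : ℝ) := by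
        rw [hodFrame, if_pos hk, ← hn]
        nth_rw 2 [← one_smul ℝ (EuclideanSpace.single k (1 : ℝ))]
        rw [← sub_smul]
        congr 1
        field_simp
        ring
      rw [this, norm_smul, PiLp.norm_single, norm_one, mul_one, Real.norm_eq_abs, abs_div,
        abs_neg, abs_of_pos hpn', div_le_iff₀ hpn']
      nlinarith [hp n]
    · rw [hodFrame, if_neg hk, ← hn, add_sub_cancel_left, norm_smul, PiLp.norm_single,
        norm_one, mul_one, Real.norm_eq_abs, abs_div, abs_of_pos hpn', div_le_iff₀ hpn']
      nlinarith [hp k]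
  · simp only [hodNormal, ← hn, PiLp.sub_apply, PiLp.smul_apply, WithLp.ofLp_sum, Finset.sum_apply]
    rw [Finset.sum_eq_zero]
    · simp
    · intro m _
      split_ifs with hm
      · simp
      · simp [Ne.symm hm]
  · have hs : (√(1 + tangSq d hd p) + 1)⁻¹ ≤ 1 :=
      inv_le_one_of_one_le₀ (by linarith [Real.sqrt_nonneg (1 + tangSq d hd p)])
    have hsum : ‖∑ m, if m = n then 0 else p m • EuclideanSpace.single m (1 : ℝ)‖ ≤ d * η := by
      refine (norm_sum_le _ _).trans ?_
      have : ∀ m ∈ Finset.univ, ‖if m = n then 0 else p m • EuclideanSpace.single m (1 : ℝ)‖ ≤ η := by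
        intro m _
        split_ifs
        · simpa using hη0
        · simpa [norm_smul] using hp m
      simpa using Finset.sum_le_card_nsmul _ _ _ this
    rw [hodNormal, ← hn, sub_sub_cancel_left, norm_neg, norm_smul, Real.norm_eq_abs,
      abs_of_nonneg (by positivity)]
    calc _ ≤ 1 * (d * η) := by gcongr
      _ ≤ (d + 2) * η := by linarith

theorem fderiv_hodNormal :
    fderiv ℝ v y (hodNormal d hd fun m => gradC d v y m) =
      gradC d v y (lastIdx d hd) - hodN d hd fun m => gradC d v y m := by
  set n := lastIdx d hd with hn
  set p : Fin d → ℝ := fun m => gradC d v y m with hp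
  have hT := tangSq_nonneg (hd := hd) p
  have hsum : fderiv ℝ v y (∑ m, if m = n then 0 else p m • EuclideanSpace.single m (1 : ℝ)) =
      tangSq d hd p := by
    rw [map_sum, tangSq]
    refine Finset.sum_congr rfl fun m _ => ?_
    rw [← hn]
    split_ifs
    · simp
    · simp [hp, gradC, sq]
  rw [hodNormal, map_sub, map_smul, ← hn, hsum, hodN, gradC, smul_eq_mul]
  have h1 : √(1 + tangSq d hd p) ^ 2 = 1 + tangSq d hd p := Real.sq_sqrt (by linarith)
  have h2 : √(1 + tangSq d hd p) + 1 ≠ 0 := by positivity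
  congr 1
  rw [inv_mul_eq_div, div_eq_iff h2]
  linear_combination -h1

theorem IsHodSol.isFrameSol {η : ℝ} {U : Set (EuclideanSpace ℝ (Fin d))} (h : IsHodSol d hd v U)
    (hη : η ≤ 1 / 2) (hv : ∀ y ∈ U, ‖fderiv ℝ v y‖ ≤ η) :
    IsFrameSol (lastIdx d hd) ((d + 2) * η) U v := by
  obtain ⟨⟨W, hW, hUW, hvW⟩, hint, hbd⟩ := h
  have hsm : ∀ y ∈ U, ContDiffAt ℝ 2 v y := fun y hy =>
    (hvW.contDiffAt (hW.mem_nhds (hUW hy))).of_le (WithTop.coe_le_coe.2 (le_top (a := (2 : ℕ∞))))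
  refine ⟨fun y hy => (hsm y hy).continuousAt.continuousWithinAt, fun y hy => ?_,
    fun y hy z hz hyz => ?_⟩
  · refine ⟨_, _, isNearFrame_hodFrame hη (p := fun m => gradC d v y m)
      fun i => abs_gradC_le (hv y hy) i, fun hyn => ?_, fun hyn => ?_⟩
    · refine ⟨_, fun k => .of_contDiffAt (hsm y hy) _, ?_⟩
      rw [sum_hodFrame, ← hint y hy hyn, hodOp]
      simp only [hessC_eq (hsm y hy)]
    · have hz : fderiv ℝ v y (hodNormal d hd fun m => gradC d v y m) = 0 := by
        rw [fderiv_hodNormal, hbd y hy hyn, sub_self]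
      have hline : HasDerivAt (fun t : ℝ => y + t • hodNormal d hd fun m => gradC d v y m)
          (hodNormal d hd fun m => gradC d v y m) 0 := by
        simpa using ((hasDerivAt_id (0 : ℝ)).smul_const
          (hodNormal d hd fun m => gradC d v y m)).const_add y
      have hf : HasFDerivAt v (fderiv ℝ v y)
          (y + (0 : ℝ) • hodNormal d hd fun m => gradC d v y m) := by
        simpa using ((hsm y hy).differentiableAt (by simp)).hasFDerivAt
      have := hf.comp_hasDerivAt (0 : ℝ) hline
      rwa [hz] at this
  · have := (convex_segment y z).norm_image_sub_le_of_norm_fderiv_le (𝕜 := ℝ) (C := 1)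
      (fun x hx => (hsm x (hyz hx)).differentiableAt (by simp))
      (fun x hx => (hv x (hyz hx)).trans (by linarith))
      (right_mem_segment ℝ y z) (left_mem_segment ℝ y z)
    simpa [Real.norm_eq_abs, dist_eq_norm] using this

end

theorem euclidean_norm_le_of_abs_le {d : ℕ} {z : EuclideanSpace ℝ (Fin d)} {ℓ : ℝ} (hℓ : 0 ≤ ℓ)
    (h : ∀ i, |z i| ≤ ℓ) : ‖z‖ ≤ d * ℓ := by
  rw [EuclideanSpace.norm_eq]
  refine Real.sqrt_le_iff.2 ⟨by positivity, ?_⟩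
  have h1 : ∑ i, ‖z i‖ ^ 2 ≤ d * ℓ ^ 2 := by
    have : ∀ i ∈ Finset.univ, ‖z i‖ ^ 2 ≤ ℓ ^ 2 := fun i _ =>
      pow_le_pow_left₀ (norm_nonneg _) (h i) 2
    simpa using Finset.sum_le_card_nsmul _ _ _ this
  have h2 : (d : ℝ) ≤ (d : ℝ) ^ 2 := by exact_mod_cast Nat.le_self_pow two_ne_zero d
  calc _ ≤ d * ℓ ^ 2 := h1
    _ ≤ (d : ℝ) ^ 2 * ℓ ^ 2 := by gcongr
    _ = (d * ℓ) ^ 2 := by ring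

theorem card_Icc_ceil_floor (a b : ℝ) (hab : a ≤ b + 1) :
    b - a - 1 ≤ ((Finset.Icc ⌈a⌉ ⌊b⌋).card : ℝ) ∧ ((Finset.Icc ⌈a⌉ ⌊b⌋).card : ℝ) ≤ b - a + 1 := by
  have h1 := Int.ceil_lt_add_one a
  have h2 := Int.lt_floor_add_one b
  have h3 := Int.le_ceil a
  have h4 := Int.floor_le b
  rw [Int.card_Icc]
  have h5 : ((⌊b⌋ + 1 - ⌈a⌉ : ℤ) : ℝ) ≤ ((⌊b⌋ + 1 - ⌈a⌉).toNat : ℝ) := by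
    exact_mod_cast Int.self_le_toNat _
  push_cast at h5
  refine ⟨by linarith, ?_⟩
  rcases le_total 0 (⌊b⌋ + 1 - ⌈a⌉) with h | h
  · have h6 : ((⌊b⌋ + 1 - ⌈a⌉).toNat : ℝ) = ((⌊b⌋ + 1 - ⌈a⌉ : ℤ) : ℝ) := by
      exact_mod_cast Int.toNat_of_nonneg h
    rw [h6]
    push_cast
    linarith
  · rw [Int.toNat_of_nonpos h]
    push_cast
    linarith

/-- A cube of side `ℓ` contains many points of the lattice of mesh `h`, and balls contain few. -/
theorem exists_lattice {d : ℕ} (x₀ : EuclideanSpace ℝ (Fin d)) {ℓ h : ℝ} (hh : 0 < h)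
    (hℓ : 2 * h ≤ ℓ) :
    ∃ S : Finset (EuclideanSpace ℝ (Fin d)), (∀ x ∈ S, ∀ i, x₀ i ≤ x i ∧ x i ≤ x₀ i + ℓ) ∧
      (ℓ / (2 * h)) ^ d ≤ (S.card : ℝ) ∧ ∀ T ⊆ S, ∀ y r, h ≤ r → (∀ x ∈ T, dist y x ≤ r) →
        (T.card : ℝ) ≤ (3 * r / h) ^ d := by
  classical
  set φ : (Fin d → ℤ) → EuclideanSpace ℝ (Fin d) := fun k => WithLp.toLp 2 fun i => h * k i with hφ
  have hφi : Function.Injective φ := by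
    intro k k' hkk
    funext i
    have : h * (k i : ℝ) = h * k' i := congrArg (fun z : EuclideanSpace ℝ (Fin d) => z i) hkk
    exact_mod_cast mul_left_cancel₀ hh.ne' this
  set I : Fin d → Finset ℤ := fun i => Finset.Icc ⌈x₀ i / h⌉ ⌊(x₀ i + ℓ) / h⌋ with hI
  refine ⟨(Fintype.piFinset I).image φ, fun x hx i => ?_, ?_, fun T hT y r hr hTr => ?_⟩
  · obtain ⟨k, hk, rfl⟩ := Finset.mem_image.1 hx
    have hki := Finset.mem_Icc.1 (Fintype.mem_piFinset.1 hk i)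
    have h1 := (div_le_iff₀ hh).1 (Int.ceil_le.1 hki.1)
    have h2 := (le_div_iff₀ hh).1 (Int.le_floor.1 hki.2)
    simp only [hφ]
    exact ⟨by linarith, by linarith⟩
  · rw [Finset.card_image_of_injective _ hφi, Fintype.card_piFinset]
    push_cast
    have hI' : ∀ i, ℓ / (2 * h) ≤ ((I i).card : ℝ) := by
      intro i
      have h0 : (x₀ i + ℓ) / h - x₀ i / h = ℓ / h := by ring
      have h1 : 2 ≤ ℓ / h := (le_div_iff₀ hh).2 hℓ
      have h2 : ℓ / (2 * h) = ℓ / h / 2 := by field_simp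
      have := (card_Icc_ceil_floor (x₀ i / h) ((x₀ i + ℓ) / h) (by linarith)).1
      rw [h2]
      simp only [hI]
      linarith
    have hpos : 0 ≤ ℓ / (2 * h) := div_nonneg (by linarith) (by positivity)
    have := Finset.prod_le_prod (s := Finset.univ) (fun i _ => hpos) fun i _ => hI' i
    rwa [Finset.prod_const, Finset.card_univ, Fintype.card_fin] at this
  · set J : Fin d → Finset ℤ := fun i => Finset.Icc ⌈(y i - r) / h⌉ ⌊(y i + r) / h⌋ with hJ
    have hsub : T ⊆ (Fintype.piFinset J).image φ := by
      intro x hx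
      obtain ⟨k, -, rfl⟩ := Finset.mem_image.1 (hT hx)
      refine Finset.mem_image_of_mem _ (Fintype.mem_piFinset.2 fun i => ?_)
      have h1 : |y i - h * k i| ≤ r := by
        have := (PiLp.norm_apply_le (y - φ k) i).trans_eq (dist_eq_norm _ _).symm
        simpa [hφ] using this.trans (hTr _ hx)
      obtain ⟨h2, h3⟩ := abs_le.1 h1
      refine Finset.mem_Icc.2 ⟨Int.ceil_le.2 ((div_le_iff₀ hh).2 ?_),
        Int.le_floor.2 ((le_div_iff₀ hh).2 ?_)⟩ <;> linarith
    have hJ' : ∀ i, ((J i).card : ℝ) ≤ 3 * r / h := by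
      intro i
      have h0 : (y i + r) / h - (y i - r) / h = 2 * (r / h) := by ring
      have h1 : 1 ≤ r / h := (one_le_div hh).2 hr
      have := (card_Icc_ceil_floor ((y i - r) / h) ((y i + r) / h) (by linarith)).2
      simp only [hJ]
      rw [mul_div_assoc]
      linarith
    calc (T.card : ℝ) ≤ ((Fintype.piFinset J).card : ℝ) := by
          rw [← Finset.card_image_of_injective _ hφi]
          exact_mod_cast Finset.card_le_card hsub
      _ = ∏ i, ((J i).card : ℝ) := by rw [Fintype.card_piFinset]; push_cast; rfl
      _ ≤ (3 * r / h) ^ d := by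
          have := Finset.prod_le_prod (s := Finset.univ)
            (fun i _ => Nat.cast_nonneg (J i).card) fun i _ => hJ' i
          rwa [Finset.prod_const, Finset.card_univ, Fintype.card_fin] at this

/-- Sums of the critical power over dyadic balls. -/
theorem sum_inv_dist_pow_le {d s : ℕ} (hds : d = s + 1) {T : Finset (EuclideanSpace ℝ (Fin d))}
    {y : EuclideanSpace ℝ (Fin d)} {h : ℝ} (hh : 0 < h)
    (hcount : ∀ T' ⊆ T, ∀ r, h ≤ r → (∀ x ∈ T', dist y x ≤ r) → (T'.card : ℝ) ≤ (3 * r / h) ^ d)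
    (hfar : ∀ x ∈ T, h ≤ dist y x) (N : ℕ) :
    ∑ x ∈ T with dist y x ≤ 2 ^ N * h, (dist y x ^ s)⁻¹ ≤ 3 ^ d * 2 ^ d * 2 ^ N * (h ^ s)⁻¹ := by
  induction N with
  | zero =>
    have hc := hcount (T.filter fun x => dist y x ≤ 2 ^ 0 * h) (Finset.filter_subset _ _) h le_rfl
      fun x hx => by simpa using (Finset.mem_filter.1 hx).2
    rw [mul_div_assoc, div_self hh.ne', mul_one] at hc
    have : ∀ x ∈ T.filter fun x => dist y x ≤ 2 ^ 0 * h, (dist y x ^ s)⁻¹ ≤ (h ^ s)⁻¹ := by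
      intro x hx
      have := hfar x (Finset.mem_filter.1 hx).1
      gcongr
    refine (Finset.sum_le_card_nsmul _ _ _ this).trans ?_
    rw [nsmul_eq_mul, pow_zero, mul_one]
    gcongr
    refine hc.trans (le_mul_of_one_le_right (by positivity) (one_le_pow₀ one_le_two))
  | succ N ih =>
    have hsub : (T.filter fun x => dist y x ≤ 2 ^ N * h) ⊆
        T.filter fun x => dist y x ≤ 2 ^ (N + 1) * h := by
      intro x hx
      rw [Finset.mem_filter] at hx ⊢
      refine ⟨hx.1, hx.2.trans ?_⟩
      gcongr <;> simp
    rw [← Finset.sum_sdiff hsub]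
    set R := (T.filter fun x => dist y x ≤ 2 ^ (N + 1) * h) \
      T.filter fun x => dist y x ≤ 2 ^ N * h with hR
    have hRm : ∀ x ∈ R, x ∈ T ∧ dist y x ≤ 2 ^ (N + 1) * h ∧ 2 ^ N * h < dist y x := by
      intro x hx
      simp only [hR, Finset.mem_sdiff, Finset.mem_filter, not_and, not_le] at hx
      exact ⟨hx.1.1, hx.1.2, hx.2 hx.1.1⟩
    have hc := hcount R (fun x hx => (hRm x hx).1) (2 ^ (N + 1) * h)
      (le_mul_of_one_le_left hh.le (one_le_pow₀ one_le_two)) fun x hx => (hRm x hx).2.1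
    have : ∀ x ∈ R, (dist y x ^ s)⁻¹ ≤ ((2 ^ N * h) ^ s)⁻¹ := by
      intro x hx
      have := (hRm x hx).2.2.le
      gcongr
    have h1 : ∑ x ∈ R, (dist y x ^ s)⁻¹ ≤ 3 ^ d * 2 ^ d * 2 ^ N * (h ^ s)⁻¹ := by
      refine (Finset.sum_le_card_nsmul _ _ _ this).trans ?_
      rw [nsmul_eq_mul]
      calc (R.card : ℝ) * ((2 ^ N * h) ^ s)⁻¹
          ≤ (3 * (2 ^ (N + 1) * h) / h) ^ d * ((2 ^ N * h) ^ s)⁻¹ := by gcongr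
        _ = 3 ^ d * 2 ^ d * 2 ^ N * (h ^ s)⁻¹ := by
          subst hds
          have : 3 * (2 ^ (N + 1) * h) / h = 3 * 2 * 2 ^ N := by field_simp; ring
          rw [this, mul_pow, mul_pow]
          field_simp
          ring
    calc _ ≤ 3 ^ d * 2 ^ d * 2 ^ N * (h ^ s)⁻¹ + 3 ^ d * 2 ^ d * 2 ^ N * (h ^ s)⁻¹ :=
          add_le_add h1 ih
      _ = _ := by ring

/-- Lattice points in a cube: there are many of them, but the potential of any part of them is
bounded away from the points. -/
theorem exists_lattice_potential_le {d : ℕ} (hd : 1 ≤ d) (x₀ : EuclideanSpace ℝ (Fin d)) {ℓ h : ℝ}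
    (hh : 0 < h) (hℓ : 2 * h ≤ ℓ) :
    ∃ S : Finset (EuclideanSpace ℝ (Fin d)), (∀ x ∈ S, ∀ i, x₀ i ≤ x i) ∧
      (∀ x ∈ S, dist x x₀ ≤ d * ℓ) ∧ (ℓ / (2 * h)) ^ d ≤ (S.card : ℝ) ∧
      ∀ T ⊆ S, ∀ y, (∀ x ∈ T, h ≤ dist y x) →
        ∑ x ∈ T, (dist y x ^ (d - 1))⁻¹ ≤ 3 ^ d * (2 ^ (d + 1) + d ^ d) * (ℓ / h ^ d) := by
  obtain ⟨s, rfl⟩ : ∃ s, d = s + 1 := ⟨d - 1, by omega⟩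
  obtain ⟨S, hS, hcard, hcount⟩ := exists_lattice x₀ hh hℓ
  have hℓ0 : 0 < ℓ := by linarith
  have hdist : ∀ x ∈ S, dist x x₀ ≤ ((s + 1 : ℕ) : ℝ) * ℓ := by
    intro x hx
    rw [dist_eq_norm]
    refine euclidean_norm_le_of_abs_le hℓ0.le fun i => ?_
    rw [PiLp.sub_apply, abs_le]
    constructor <;> linarith [(hS x hx i).1, (hS x hx i).2]
  refine ⟨S, fun x hx i => (hS x hx i).1, hdist, hcard, fun T hT y hfar => ?_⟩
  obtain ⟨m, hm1, hm2⟩ := exists_nat_pow_near (x := ℓ / h) (y := (2 : ℝ))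
    ((one_le_div hh).2 (by linarith)) one_lt_two
  rw [le_div_iff₀ hh] at hm1
  rw [div_lt_iff₀ hh] at hm2
  have hnear := sum_inv_dist_pow_le rfl hh (fun T' hT' r => hcount T' (hT'.trans hT) y r) hfar (m + 1)
  have hTcard : (T.card : ℝ) ≤ (3 * ((s + 1 : ℕ) * ℓ) / h) ^ (s + 1) := by
    refine hcount T hT x₀ _ ?_ fun x hx => by rw [dist_comm]; exact hdist x (hT hx)
    have : (1 : ℝ) ≤ (s + 1 : ℕ) := by exact_mod_cast hd
    nlinarith
  have hfar' : ∑ x ∈ T with ¬ dist y x ≤ 2 ^ (m + 1) * h, (dist y x ^ s)⁻¹ ≤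
      T.card * (ℓ ^ s)⁻¹ := by
    have : ∀ x ∈ T.filter fun x => ¬ dist y x ≤ 2 ^ (m + 1) * h, (dist y x ^ s)⁻¹ ≤ (ℓ ^ s)⁻¹ := by
      intro x hx
      have := (Finset.mem_filter.1 hx).2
      have : ℓ ≤ dist y x := by linarith
      gcongr
    refine (Finset.sum_le_card_nsmul _ _ _ this).trans ?_
    rw [nsmul_eq_mul]
    gcongr
    exact Finset.filter_subset _ _
  rw [Nat.add_sub_cancel, ← Finset.sum_filter_add_sum_filter_not T fun x => dist y x ≤ 2 ^ (m + 1) * h]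
  have h2 : (2 : ℝ) ^ (m + 1) ≤ 2 * (ℓ / h) := by
    rw [← mul_div_assoc, le_div_iff₀ hh, pow_succ]
    linarith
  calc _ ≤ 3 ^ (s + 1) * 2 ^ (s + 1) * 2 ^ (m + 1) * (h ^ s)⁻¹ + T.card * (ℓ ^ s)⁻¹ :=
        add_le_add hnear hfar'
    _ ≤ 3 ^ (s + 1) * 2 ^ (s + 1) * (2 * (ℓ / h)) * (h ^ s)⁻¹ +
        (3 * ((s + 1 : ℕ) * ℓ) / h) ^ (s + 1) * (ℓ ^ s)⁻¹ := by gcongr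
    _ = _ := by
      simp only [div_pow, mul_pow, pow_succ]
      field_simp

/-- `Φ` is comparable to the critical power `‖z‖ ^ (-(d - 1))`, and its translates with pole in the
closed half-space are strict subsolutions for all nearly standard frames. -/
structure IsPoleKernel {d : ℕ} (n : Fin d) (η : ℝ) (Φ : EuclideanSpace ℝ (Fin d) → ℝ) : Prop where
  cont : ∀ z ≠ 0, ContinuousAt Φ z
  lower : ∀ z ≠ 0, 1 / 2 * (‖z‖ ^ (d - 1))⁻¹ ≤ Φ z
  upper : ∀ z ≠ 0, Φ z ≤ 3 / 2 * (‖z‖ ^ (d - 1))⁻¹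
  op : ∀ w ν, IsNearFrame n η w ν → ∀ x y, y ≠ x → 0 ≤ x n →
    ∃ c > 0, HasFrameOp n w ν (fun z => Φ (z - x)) y c

/-- `W` is comparable to `‖z‖ ^ (-α)` and a strict supersolution for all nearly standard frames. -/
structure IsBarrier {d : ℕ} (n : Fin d) (η α : ℝ) (W : EuclideanSpace ℝ (Fin d) → ℝ) : Prop where
  cont : ∀ z ≠ 0, ContinuousAt W z
  lower : ∀ z ≠ 0, 9 / 10 * ‖z‖ ^ (-α) ≤ W z
  upper : ∀ z, 0 ≤ z n → W z ≤ ‖z‖ ^ (-α)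
  op : ∀ w ν, IsNearFrame n η w ν → ∀ y ≠ 0, ∃ c < 0, HasFrameOp n w ν W y c

theorem IsBarrier.pos {d : ℕ} {n : Fin d} {η α : ℝ} {W : EuclideanSpace ℝ (Fin d) → ℝ}
    (h : IsBarrier n η α W) {z : EuclideanSpace ℝ (Fin d)} (hz : z ≠ 0) : 0 < W z := by
  have := norm_pos_iff.2 hz
  exact lt_of_lt_of_le (by positivity) (h.lower z hz)

theorem exists_kernels {d : ℕ} {α : ℝ} (hd : 2 ≤ d) (hα : 0 < α) (hαd : α < (d : ℝ) - 2) :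
    ∃ η > 0, ∀ n : Fin d, ∃ Φ W, IsPoleKernel n η Φ ∧ IsBarrier n η α W := by
  obtain ⟨ε, hε, hε2, η, hη, hop⟩ := exists_obliqueKernel_subsolution hd
  obtain ⟨ε', hε', hε2', η', hη', hop'⟩ := exists_obliqueKernel_supersolution hα hαd
  have hpow : ∀ z : EuclideanSpace ℝ (Fin d),
      ‖z‖ ^ (-(2 * (((d : ℝ) - 1) / 2))) = (‖z‖ ^ (d - 1))⁻¹ := by
    intro z
    rw [mul_div_cancel₀ _ two_ne_zero, Real.rpow_neg (norm_nonneg z), ← Real.rpow_natCast,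
      Nat.cast_sub (by omega), Nat.cast_one]
  have hpow' : ∀ z : EuclideanSpace ℝ (Fin d), ‖z‖ ^ (-(2 * (α / 2))) = ‖z‖ ^ (-α) := by
    intro z
    rw [mul_div_cancel₀ _ two_ne_zero]
  refine ⟨min η η', lt_min hη hη', fun n => ⟨obliqueKernel n (((d : ℝ) - 1) / 2) ε,
    obliqueKernel n (α / 2) (-ε'), ⟨fun z => continuousAt_obliqueKernel _ _, fun z hz => ?_,
    fun z hz => ?_, fun w ν hw => hop n w ν (hw.mono (min_le_left _ _))⟩,
    ⟨fun z => continuousAt_obliqueKernel _ _, fun z hz => ?_, fun z hz => ?_,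
      fun w ν hw => hop' n w ν (hw.mono (min_le_right _ _))⟩⟩⟩
  · refine le_trans ?_ (le_obliqueKernel n ε hz)
    rw [hpow, abs_of_pos hε]
    gcongr
    linarith
  · refine (obliqueKernel_le n ε hz).trans ?_
    rw [hpow, abs_of_pos hε]
    gcongr
    linarith
  · refine le_trans ?_ (le_obliqueKernel n (-ε') hz)
    rw [hpow', abs_neg, abs_of_pos hε']
    gcongr
    linarith
  · exact (obliqueKernel_neg_le n ε' hε'.le hz).trans_eq (hpow' z)

/-- Lower bound for a nonnegative solution which is large near the poles of a potential. -/
theorem potential_le {d : ℕ} {n : Fin d} {η α : ℝ} {Φ W f : EuclideanSpace ℝ (Fin d) → ℝ}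
    (hΦ : IsPoleKernel n η Φ) (hW : IsBarrier n η α W) {D : Set (EuclideanSpace ℝ (Fin d))}
    (hD : IsCompact D) (hDn : ∀ y ∈ D, 0 ≤ y n) (hD0 : ∀ y ∈ D, y ≠ 0) (hf : IsFrameSol n η D f)
    (hf0 : ∀ y ∈ D, 0 ≤ f y) {T : Finset (EuclideanSpace ℝ (Fin d))} (hT : ∀ x ∈ T, 0 ≤ x n)
    {h P τ a b : ℝ} (hh : 0 < h) (hP : 0 < P) (hτ : 0 < τ) (ha : 0 ≤ a) (hb : 0 ≤ b)
    (hPle : ∀ y ∈ D, (∀ x ∈ T, h ≤ dist y x) → ∑ x ∈ T, Φ (y - x) ≤ P)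
    (hfτ : ∀ y ∈ D, ∀ x ∈ T, dist y x ≤ h → τ ≤ f y)
    (hbd : ∀ y ∈ D, (∀ x ∈ T, h ≤ dist y x) → ∑ x ∈ T, Φ (y - x) ≤ a + b * W y ∨
      ∃ r > 0, ∀ z, 0 ≤ z n → dist z y < r → z ∈ D) :
    ∀ y ∈ D, (∀ x ∈ T, h ≤ dist y x) → τ / P * (∑ x ∈ T, Φ (y - x) - (a + b * W y)) ≤ f y := by
  set κ := τ / P with hκdef
  have hκ : 0 < κ := div_pos hτ hP
  rcases T.eq_empty_or_nonempty with rfl | hTne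
  · intro y hy _
    have : 0 ≤ a + b * W y := add_nonneg ha (mul_nonneg hb (hW.pos (hD0 y hy)).le)
    rw [Finset.sum_empty]
    nlinarith [hf0 y hy]
  set Q : Set (EuclideanSpace ℝ (Fin d)) := D ∩ {y | ∀ x ∈ T, h ≤ dist y x} with hQ
  have hQc : IsCompact Q := by
    refine hD.inter_right ?_
    have : {y : EuclideanSpace ℝ (Fin d) | ∀ x ∈ T, h ≤ dist y x} =
        ⋂ x ∈ T, {y | h ≤ dist y x} := by
      ext
      simp
    rw [this]
    exact isClosed_biInter fun x _ => isClosed_le continuous_const (by fun_prop)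
  have hne : ∀ y ∈ Q, ∀ x ∈ T, y ≠ x := by
    rintro y hy x hx rfl
    have := hy.2 y hx
    rw [dist_self] at this
    linarith
  have key := nonneg_of_strict_supersolution (n := n) hQc
    (f := fun y => f y + (-κ * ∑ x ∈ T, Φ (y - x) + κ * (a + b * W y))) ?_ ?_
  · intro y hy hyT
    have := key y ⟨hy, hyT⟩
    linarith
  · refine (hf.cont.mono inter_subset_left).add (ContinuousOn.add (continuousOn_const.mul ?_) ?_)
    · refine continuousOn_finsetSum _ fun x hx y hy => ?_
      have hc : ContinuousAt (fun y : EuclideanSpace ℝ (Fin d) => y - x) y := by fun_prop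
      exact (ContinuousAt.comp' (f := fun y => y - x) (g := Φ)
        (hΦ.cont _ (sub_ne_zero.2 (hne y hy x hx))) hc).continuousWithinAt
    · exact fun y hy => (((hW.cont y (hD0 y hy.1)).const_mul b).const_add a).const_mul κ
        |>.continuousWithinAt
  · intro y hy hneg
    have hWy := hW.pos (hD0 y hy.1)
    have hfar : ∀ x ∈ T, h < dist y x := by
      intro x hx
      by_contra! hle
      have h1 := hfτ y hy.1 x hx hle
      have h2 := mul_le_mul_of_nonneg_left (hPle y hy.1 hy.2) hκ.le
      have h3 : κ * P = τ := div_mul_cancel₀ τ hP.ne'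
      have h4 : 0 ≤ κ * (a + b * W y) := by positivity
      linarith
    obtain ⟨r, hr, hrD⟩ : ∃ r > 0, ∀ z, 0 ≤ z n → dist z y < r → z ∈ D := by
      refine (hbd y hy.1 hy.2).resolve_left fun hle => ?_
      have := mul_le_mul_of_nonneg_left hle hκ.le
      linarith [hf0 y hy.1]
    have hopen : IsOpen {y : EuclideanSpace ℝ (Fin d) | ∀ x ∈ T, h < dist y x} := by
      have : {y : EuclideanSpace ℝ (Fin d) | ∀ x ∈ T, h < dist y x} =
          ⋂ x ∈ T, {y | h < dist y x} := by
        ext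
        simp
      rw [this]
      exact isOpen_biInter_finset fun x _ => isOpen_lt continuous_const (by fun_prop)
    obtain ⟨r', hr', hball⟩ := Metric.isOpen_iff.1 hopen y hfar
    refine ⟨hDn y hy.1, ⟨min r r', lt_min hr hr', fun z hz hzr => ⟨hrD z hz
      (hzr.trans_le (min_le_left _ _)), fun x hx => ?_⟩⟩, ?_⟩
    · exact (hball (Metric.mem_ball.2 (hzr.trans_le (min_le_right _ _))) x hx).le
    · obtain ⟨w, ν, hw, hop⟩ := hf.op y hy.1
      have hpole : ∀ x, ∃ c, x ∈ T → 0 < c ∧ HasFrameOp n w ν (fun z => Φ (z - x)) y c := by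
        intro x
        by_cases hx : x ∈ T
        · obtain ⟨c, hc, hop⟩ := hΦ.op w ν hw x y (hne y hy x hx) (hT x hx)
          exact ⟨c, fun _ => ⟨hc, hop⟩⟩
        · exact ⟨0, fun h => absurd h hx⟩
      choose C hC using hpole
      obtain ⟨c, hc, hopW⟩ := hW.op w ν hw y (hD0 y hy.1)
      refine ⟨w, ν, 0 + (-κ * ∑ x ∈ T, C x + κ * (0 + b * c)), hw.normal, ?_,
        hop.add (((HasFrameOp.sum T fun x hx => (hC x hx).2).const_mul _).add
          (((HasFrameOp.const a).add (hopW.const_mul b)).const_mul κ))⟩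
      have h1 : 0 < ∑ x ∈ T, C x := Finset.sum_pos (fun x hx => (hC x hx).1) hTne
      have h2 : b * c ≤ 0 := mul_nonpos_of_nonneg_of_nonpos hb hc.le
      nlinarith

/-- The part of the closed half-space `0 ≤ y n` outside the ball of radius `r`. -/
def farHalf {d : ℕ} (n : Fin d) (r : ℝ) : Set (EuclideanSpace ℝ (Fin d)) :=
  {y | 0 ≤ y n ∧ r ≤ ‖y‖}

/-- The constant in the potential bound for lattice points. -/
def latticeConst (d : ℕ) : ℝ := 3 ^ d * (2 ^ (d + 1) + d ^ d)

theorem latticeConst_pos (d : ℕ) : 0 < latticeConst d := by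
  unfold latticeConst
  positivity

section

variable {d : ℕ} {n : Fin d} {η α : ℝ} {Φ W u : EuclideanSpace ℝ (Fin d) → ℝ}

theorem convex_halfSpace (n : Fin d) : Convex ℝ {y : EuclideanSpace ℝ (Fin d) | 0 ≤ y n} := by
  intro x hx y hy a b ha hb _
  have hx' : 0 ≤ x n := hx
  have hy' : 0 ≤ y n := hy
  change 0 ≤ (a • x + b • y) n
  simp only [PiLp.add_apply, PiLp.smul_apply, smul_eq_mul]
  positivity

theorem isClosed_halfSpace (n : Fin d) : IsClosed {y : EuclideanSpace ℝ (Fin d) | 0 ≤ y n} :=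
  isClosed_le continuous_const (by fun_prop)

theorem IsFrameSol.abs_sub_le {r ρ : ℝ} (hu : IsFrameSol n η (farHalf n r) u)
    {x y z : EuclideanSpace ℝ (Fin d)} (hx : r + ρ ≤ ‖x‖) (hy : 0 ≤ y n) (hz : 0 ≤ z n)
    (hyx : dist y x ≤ ρ) (hzx : dist z x ≤ ρ) : |u y - u z| ≤ dist y z := by
  have hsub : Metric.closedBall x ρ ∩ {y | 0 ≤ y n} ⊆ farHalf n r := by
    rintro w ⟨hw, hwn⟩
    refine ⟨hwn, ?_⟩
    have h1 := norm_sub_norm_le x w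
    rw [← dist_eq_norm, dist_comm] at h1
    linarith [Metric.mem_closedBall.1 hw]
  have hconv := (convex_closedBall x ρ).inter (convex_halfSpace n)
  have hy' : y ∈ Metric.closedBall x ρ ∩ {y | 0 ≤ y n} := ⟨hyx, hy⟩
  have hz' : z ∈ Metric.closedBall x ρ ∩ {y | 0 ≤ y n} := ⟨hzx, hz⟩
  exact hu.lip y (hsub hy') z (hsub hz') ((hconv.segment_subset hy' hz').trans hsub)

theorem IsPoleKernel.sum_le (hΦ : IsPoleKernel n η Φ) {T : Finset (EuclideanSpace ℝ (Fin d))}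
    {y : EuclideanSpace ℝ (Fin d)} {ρ : ℝ} (hρ : 0 < ρ) (h : ∀ x ∈ T, ρ ≤ dist y x) :
    ∑ x ∈ T, Φ (y - x) ≤ 3 / 2 * (T.card * (ρ ^ (d - 1))⁻¹) := by
  have : ∀ x ∈ T, Φ (y - x) ≤ 3 / 2 * (ρ ^ (d - 1))⁻¹ := by
    intro x hx
    have h1 := h x hx
    rw [dist_eq_norm] at h1
    refine (hΦ.upper _ (norm_pos_iff.1 (hρ.trans_le h1))).trans ?_
    gcongr
  refine (Finset.sum_le_card_nsmul _ _ _ this).trans_eq ?_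
  rw [nsmul_eq_mul]
  ring

theorem IsPoleKernel.le_sum (hΦ : IsPoleKernel n η Φ) {T : Finset (EuclideanSpace ℝ (Fin d))}
    {y : EuclideanSpace ℝ (Fin d)} {ρ : ℝ} (h : ∀ x ∈ T, dist y x ≤ ρ) (hne : ∀ x ∈ T, y ≠ x) :
    1 / 2 * (T.card * (ρ ^ (d - 1))⁻¹) ≤ ∑ x ∈ T, Φ (y - x) := by
  have : ∀ x ∈ T, 1 / 2 * (ρ ^ (d - 1))⁻¹ ≤ Φ (y - x) := by
    intro x hx
    have h1 := h x hx
    have h2 := sub_ne_zero.2 (hne x hx)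
    have h3 := norm_pos_iff.2 h2
    rw [dist_eq_norm] at h1
    refine le_trans ?_ (hΦ.lower _ h2)
    gcongr
  refine le_trans (le_of_eq ?_) (Finset.card_nsmul_le_sum _ _ _ this)
  rw [nsmul_eq_mul]
  ring

theorem isCompact_halfAnnulus (n : Fin d) (r R : ℝ) :
    IsCompact {y : EuclideanSpace ℝ (Fin d) | 0 ≤ y n ∧ r ≤ ‖y‖ ∧ ‖y‖ ≤ R} := by
  refine (isCompact_closedBall (0 : EuclideanSpace ℝ (Fin d)) R).of_isClosed_subset ?_
    fun y hy => by simpa using hy.2.2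
  exact (isClosed_halfSpace n).inter ((isClosed_le continuous_const continuous_norm).inter
    (isClosed_le continuous_norm continuous_const))

/-- If a nonnegative exterior solution is at least `t` on many lattice points of a cube, it is
bounded below by a multiple of `t` at points which are not farther from the origin. -/
theorem le_of_many_large (hd : 3 ≤ d) (hΦ : IsPoleKernel n η Φ) (hW : IsBarrier n η α W)
    {r₀ t κ : ℝ} (hr₀ : 0 < r₀) (hu : IsFrameSol n η (farHalf n r₀) u)
    (hu0 : ∀ y ∈ farHalf n r₀, 0 ≤ u y) {ys x₀ : EuclideanSpace ℝ (Fin d)} (hys : ys ∈ farHalf n r₀)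
    (hfar : 24 * 6 ^ (d - 1) * r₀ ^ α ≤ ‖ys‖ ^ α) (hyx : ‖ys‖ ≤ ‖x₀‖) (hx₀ : 4 * r₀ ≤ ‖x₀‖)
    (hκ : 0 < κ) (hdκ : 8 * (d * κ) ≤ 1) (ht : 0 < t) (htκ : t ≤ κ * ‖x₀‖)
    {T : Finset (EuclideanSpace ℝ (Fin d))} (hTn : ∀ x ∈ T, 0 ≤ x n)
    (hTd : ∀ x ∈ T, dist x x₀ ≤ d * (κ * ‖x₀‖)) (hTu : ∀ x ∈ T, t ≤ u x)
    (hTc : (κ * ‖x₀‖ / t) ^ d ≤ 2 * (T.card : ℝ))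
    (hpot : ∀ y, (∀ x ∈ T, t / 2 ≤ dist y x) → ∑ x ∈ T, Φ (y - x) ≤
      3 / 2 * latticeConst d * (κ * ‖x₀‖ / (t / 2) ^ d)) :
    t ≤ (2 + 24 * 2 ^ d * 3 ^ (d - 1) * latticeConst d / κ ^ (d - 1)) * u ys := by
  set R := ‖x₀‖ with hR
  have hRpos : 0 < R := by linarith
  have hC := latticeConst_pos d
  have hd3 : (3 : ℝ) ≤ d := by exact_mod_cast hd
  have hs2 : 2 ≤ d - 1 := by omega
  have hκ1 : κ ≤ 1 / 24 := by nlinarith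
  have hdℓ : d * (κ * R) ≤ R / 8 := by nlinarith
  have htR : t ≤ R / 24 := htκ.trans (by nlinarith)
  have hTnorm : ∀ x ∈ T, 7 / 8 * R ≤ ‖x‖ ∧ ‖x‖ ≤ 9 / 8 * R := by
    intro x hx
    have h1 := (hTd x hx).trans hdℓ
    rw [dist_eq_norm] at h1
    have h2 := abs_le.1 ((abs_norm_sub_norm_le x x₀).trans h1)
    constructor <;> linarith [h2.1, h2.2]
  have hu_near : ∀ y, 0 ≤ y n → ∀ x ∈ T, dist y x ≤ t / 2 → t / 2 ≤ u y := by
    intro y hy x hx hyx'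
    have h1 := hu.abs_sub_le (x := x) (ρ := t / 2) (by linarith [(hTnorm x hx).1]) hy (hTn x hx)
      hyx' (by rw [dist_self]; linarith)
    linarith [(abs_le.1 h1).1, hTu x hx]
  have huys := hu0 ys hys
  have hCκ : 0 < 24 * 2 ^ d * 3 ^ (d - 1) * latticeConst d / κ ^ (d - 1) := by positivity
  by_cases hclose : ∃ x ∈ T, dist ys x < t / 2
  · obtain ⟨x, hx, hlt⟩ := hclose
    have := hu_near ys hys.1 x hx hlt.le
    nlinarith
  push Not at hclose
  set D : Set (EuclideanSpace ℝ (Fin d)) := {y | 0 ≤ y n ∧ r₀ ≤ ‖y‖ ∧ ‖y‖ ≤ 38 * R} with hD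
  have hD0 : ∀ y ∈ D, y ≠ 0 := fun y hy => norm_pos_iff.1 (hr₀.trans_le hy.2.1)
  set a : ℝ := 1 / 8 * (T.card * ((3 * R) ^ (d - 1))⁻¹) with ha
  set b : ℝ := 3 * (T.card * ((R / 2) ^ (d - 1))⁻¹) * r₀ ^ α with hb
  have hr₀α : 0 < r₀ ^ α := by positivity
  have key := potential_le hΦ hW (isCompact_halfAnnulus n r₀ (38 * R)) (fun y hy => hy.1) hD0
    (hu.mono fun y hy => ⟨hy.1, hy.2.1⟩) (fun y hy => hu0 y ⟨hy.1, hy.2.1⟩) hTn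
    (h := t / 2) (P := 3 / 2 * latticeConst d * (κ * R / (t / 2) ^ d)) (τ := t / 2) (a := a) (b := b)
    (by positivity) (by positivity) (by positivity) (by positivity) (by positivity)
    (fun y _ => hpot y) (fun y hy => hu_near y hy.1) ?_ ys ⟨hys.1, hys.2, by linarith⟩ hclose
  · have hysR : ∀ x ∈ T, dist ys x ≤ 3 * R := by
      intro x hx
      rw [dist_eq_norm]
      linarith [norm_sub_le ys x, (hTnorm x hx).2]
    have hne : ∀ x ∈ T, ys ≠ x := by
      rintro x hx rfl
      have := hclose _ hx
      rw [dist_self] at this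
      linarith
    have h1 := hΦ.le_sum hysR hne
    have hys0 : 0 < ‖ys‖ := hr₀.trans_le hys.2
    have h2 : b * W ys ≤ 1 / 8 * (T.card * ((3 * R) ^ (d - 1))⁻¹) := by
      have h3 : r₀ ^ α * ‖ys‖ ^ (-α) ≤ (24 * 6 ^ (d - 1))⁻¹ := by
        rw [Real.rpow_neg hys0.le, ← div_eq_mul_inv, div_le_iff₀ (by positivity),
          inv_mul_eq_div, le_div_iff₀ (by positivity)]
        linarith
      have h4 : ((R / 2) ^ (d - 1))⁻¹ = 6 ^ (d - 1) * ((3 * R) ^ (d - 1))⁻¹ := by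
        rw [show R / 2 = 3 * R / 6 by ring, div_pow, inv_div, div_eq_mul_inv]
      calc b * W ys ≤ b * ‖ys‖ ^ (-α) := by
            have := hW.upper ys hys.1
            gcongr
        _ = 3 * (T.card * (6 ^ (d - 1) * ((3 * R) ^ (d - 1))⁻¹)) * (r₀ ^ α * ‖ys‖ ^ (-α)) := by
            rw [hb, h4]
            ring
        _ ≤ 3 * (T.card * (6 ^ (d - 1) * ((3 * R) ^ (d - 1))⁻¹)) * (24 * 6 ^ (d - 1))⁻¹ := by
            gcongr
        _ = 1 / 8 * (T.card * ((3 * R) ^ (d - 1))⁻¹) := by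
            field_simp
            ring
    have h5 : 1 / 8 * ((κ * R / t) ^ d * ((3 * R) ^ (d - 1))⁻¹) ≤
        ∑ x ∈ T, Φ (ys - x) - (a + b * W ys) := by
      have h6 : 1 / 8 * ((κ * R / t) ^ d * ((3 * R) ^ (d - 1))⁻¹) ≤
          1 / 8 * (2 * (T.card : ℝ) * ((3 * R) ^ (d - 1))⁻¹) := by gcongr
      linarith
    have h7 : t / 2 / (3 / 2 * latticeConst d * (κ * R / (t / 2) ^ d)) *
        (1 / 8 * ((κ * R / t) ^ d * ((3 * R) ^ (d - 1))⁻¹)) ≤ u ys :=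
      (mul_le_mul_of_nonneg_left h5 (by positivity)).trans key
    have h8 : t / 2 / (3 / 2 * latticeConst d * (κ * R / (t / 2) ^ d)) *
        (1 / 8 * ((κ * R / t) ^ d * ((3 * R) ^ (d - 1))⁻¹)) =
        t / (24 * 2 ^ d * 3 ^ (d - 1) * latticeConst d / κ ^ (d - 1)) := by
      obtain ⟨s, rfl⟩ : ∃ s, d = s + 1 := ⟨d - 1, by omega⟩
      rw [Nat.add_sub_cancel]
      simp only [div_pow, mul_pow, pow_succ]
      field_simp
      norm_num
    rw [h8, div_le_iff₀ hCκ] at h7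
    linarith
  · intro y hy _
    rcases hy.2.1.eq_or_lt with h1 | h1
    · left
      have h2 : ∀ x ∈ T, R / 2 ≤ dist y x := by
        intro x hx
        have := norm_sub_norm_le x y
        rw [← dist_eq_norm, dist_comm] at this
        linarith [(hTnorm x hx).1]
      refine (hΦ.sum_le (by positivity) h2).trans ?_
      have h3 : b * (9 / 10 * r₀ ^ (-α)) ≤ b * W y := by
        have := hW.lower y (hD0 y hy)
        rw [← h1] at this
        gcongr
      have h4 : r₀ ^ α * r₀ ^ (-α) = 1 := by
        rw [← Real.rpow_add hr₀, add_neg_cancel, Real.rpow_zero]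
      have h5 : b * (9 / 10 * r₀ ^ (-α)) = 27 / 10 * (T.card * ((R / 2) ^ (d - 1))⁻¹) := by
        rw [hb]
        linear_combination 27 / 10 * (T.card * ((R / 2) ^ (d - 1))⁻¹) * h4
      have h6 : 0 ≤ (T.card : ℝ) * ((R / 2) ^ (d - 1))⁻¹ := by positivity
      have h7 : 0 ≤ a := by positivity
      linarith
    rcases hy.2.2.eq_or_lt with h2 | h2
    · left
      have h3 : ∀ x ∈ T, 36 * R ≤ dist y x := by
        intro x hx
        have := norm_sub_norm_le y x
        rw [← dist_eq_norm] at this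
        linarith [(hTnorm x hx).2]
      refine (hΦ.sum_le (by positivity) h3).trans ?_
      have h4 : ((36 * R) ^ (d - 1))⁻¹ ≤ 1 / 12 * ((3 * R) ^ (d - 1))⁻¹ := by
        rw [show 36 * R = 12 * (3 * R) by ring, mul_pow, mul_inv]
        have : ((12 : ℝ) ^ (d - 1))⁻¹ ≤ 1 / 12 := by
          rw [one_div]
          gcongr
          exact le_self_pow₀ (by norm_num) (by omega)
        gcongr
      have h5 : (0 : ℝ) ≤ b * W y := mul_nonneg (by positivity) (hW.pos (hD0 y hy)).le
      calc 3 / 2 * (T.card * ((36 * R) ^ (d - 1))⁻¹)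
          ≤ 3 / 2 * (T.card * (1 / 12 * ((3 * R) ^ (d - 1))⁻¹)) := by gcongr
        _ = a := by rw [ha]; ring
        _ ≤ a + b * W y := by linarith
    · right
      refine ⟨min (‖y‖ - r₀) (38 * R - ‖y‖), lt_min (by linarith) (by linarith), fun z hz hzy => ?_⟩
      rw [dist_eq_norm] at hzy
      have h3 := abs_lt.1 ((abs_norm_sub_norm_le z y).trans_lt hzy)
      have h4 := min_le_left (‖y‖ - r₀) (38 * R - ‖y‖)
      have h5 := min_le_right (‖y‖ - r₀) (38 * R - ‖y‖)
      exact ⟨hz, by linarith [h3.1], by linarith [h3.2]⟩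

/-- If a nonnegative exterior solution is smaller than `t` on many lattice points of a cube, its
value at the corner of the cube is smaller than its maximum over a larger ball by a definite
factor. -/
theorem le_of_many_small (hd : 3 ≤ d) (hΦ : IsPoleKernel n η Φ) (hW : IsBarrier n η α W)
    {r₀ t κ M : ℝ} (hr₀ : 0 < r₀) (hu : IsFrameSol n η (farHalf n r₀) u)
    {x₀ : EuclideanSpace ℝ (Fin d)} (hx₀n : 0 ≤ x₀ n) (hx₀ : 4 * r₀ ≤ ‖x₀‖)
    (hκ : 0 < κ) (hdκ : 8 * (d * κ) ≤ 1) (ht : 0 < t) (htκ : t ≤ κ * ‖x₀‖)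
    (hux₀ : 4 * t ≤ u x₀)
    (hM : ∀ y, 0 ≤ y n → dist y x₀ ≤ 4 * (d * (κ * ‖x₀‖)) → u y ≤ M)
    {T : Finset (EuclideanSpace ℝ (Fin d))} (hTn : ∀ x ∈ T, 0 ≤ x n)
    (hTd : ∀ x ∈ T, dist x x₀ ≤ d * (κ * ‖x₀‖)) (hTu : ∀ x ∈ T, u x < t)
    (hTc : (κ * ‖x₀‖ / t) ^ d ≤ 2 * (T.card : ℝ))
    (hpot : ∀ y, (∀ x ∈ T, t / 2 ≤ dist y x) → ∑ x ∈ T, Φ (y - x) ≤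
      3 / 2 * latticeConst d * (κ * ‖x₀‖ / (t / 2) ^ d)) :
    u x₀ ≤ (1 - (18 * 2 ^ d * d ^ (d - 1) * latticeConst d)⁻¹) * M := by
  set R := ‖x₀‖ with hR
  have hRpos : 0 < R := by linarith
  have hC := latticeConst_pos d
  have hd3 : (3 : ℝ) ≤ d := by exact_mod_cast hd
  have hκ1 : κ ≤ 1 / 24 := by nlinarith
  set L := d * (κ * R) with hL
  have hLpos : 0 < L := by positivity
  have hLR : L ≤ R / 8 := by rw [hL]; nlinarith
  have htR : t ≤ R / 24 := htκ.trans (by nlinarith)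
  have htL : t ≤ L := by rw [hL]; nlinarith
  have hlip : ∀ y z, 0 ≤ y n → 0 ≤ z n → dist y x₀ ≤ 4 * L → dist z x₀ ≤ 4 * L →
      |u y - u z| ≤ dist y z := fun y z hy hz hyx hzx =>
    hu.abs_sub_le (by linarith) hy hz hyx hzx
  have hux₀M : u x₀ ≤ M := hM x₀ hx₀n (by rw [dist_self]; positivity)
  set D : Set (EuclideanSpace ℝ (Fin d)) := Metric.closedBall x₀ (4 * L) ∩ {y | 0 ≤ y n} with hD
  have hDfar : D ⊆ farHalf n r₀ := by
    rintro y ⟨hy, hyn⟩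
    refine ⟨hyn, ?_⟩
    have h1 := norm_sub_norm_le x₀ y
    rw [← dist_eq_norm, dist_comm] at h1
    linarith [Metric.mem_closedBall.1 hy]
  have hD0 : ∀ y ∈ D, y ≠ 0 := fun y hy => norm_pos_iff.1 (hr₀.trans_le (hDfar hy).2)
  set a : ℝ := 1 / 6 * (T.card * (L ^ (d - 1))⁻¹) with ha
  have hclose : ∀ x ∈ T, t / 2 ≤ dist x₀ x := by
    intro x hx
    by_contra! hlt
    have h1 := hlip x₀ x hx₀n (hTn x hx) (by rw [dist_self]; positivity)
      ((hTd x hx).trans (by linarith))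
    linarith [(abs_le.1 h1).2, hTu x hx]
  have key := potential_le hΦ hW (D := D)
    ((isCompact_closedBall x₀ (4 * L)).inter_right (isClosed_halfSpace n)) (fun y hy => hy.2) hD0
    ((hu.mono hDfar).neg.add_const M) (fun y hy => by linarith [hM y hy.2 hy.1]) hTn
    (h := t / 2) (P := 3 / 2 * latticeConst d * (κ * R / (t / 2) ^ d)) (τ := M / 2) (a := a) (b := 0)
    (by positivity) (by positivity) (by linarith) (by positivity) le_rfl
    (fun y _ => hpot y) ?_ ?_ x₀ ⟨by simp; positivity, hx₀n⟩ hclose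
  · have hne : ∀ x ∈ T, x₀ ≠ x := by
      rintro x hx rfl
      have := hclose _ hx
      rw [dist_self] at this
      linarith
    have h1 := hΦ.le_sum (fun x hx => by rw [dist_comm]; exact hTd x hx) hne
    have h5 : 1 / 6 * ((κ * R / t) ^ d * (L ^ (d - 1))⁻¹) ≤
        ∑ x ∈ T, Φ (x₀ - x) - (a + 0 * W x₀) := by
      have h6 : 1 / 6 * ((κ * R / t) ^ d * (L ^ (d - 1))⁻¹) ≤
          1 / 6 * (2 * (T.card : ℝ) * (L ^ (d - 1))⁻¹) := by gcongr
      linarith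
    have h7 : M / 2 / (3 / 2 * latticeConst d * (κ * R / (t / 2) ^ d)) *
        (1 / 6 * ((κ * R / t) ^ d * (L ^ (d - 1))⁻¹)) ≤ -u x₀ + M := by
      refine (mul_le_mul_of_nonneg_left h5 ?_).trans key
      have : 0 ≤ M := by linarith
      positivity
    have h8 : M / 2 / (3 / 2 * latticeConst d * (κ * R / (t / 2) ^ d)) *
        (1 / 6 * ((κ * R / t) ^ d * (L ^ (d - 1))⁻¹)) =
        M * (18 * 2 ^ d * d ^ (d - 1) * latticeConst d)⁻¹ := by
      rw [hL]
      obtain ⟨s, rfl⟩ : ∃ s, d = s + 1 := ⟨d - 1, by omega⟩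
      rw [Nat.add_sub_cancel]
      simp only [div_pow, mul_pow, pow_succ]
      field_simp
      ring
    rw [h8] at h7
    linarith
  · intro y hy x hx hyx
    have h1 := hlip y x hy.2 (hTn x hx) hy.1 ((hTd x hx).trans (by linarith))
    linarith [(abs_le.1 h1).2, hTu x hx]
  · intro y hy _
    rcases (Metric.mem_closedBall.1 hy.1).eq_or_lt with h1 | h1
    · left
      have h2 : ∀ x ∈ T, 3 * L ≤ dist y x := by
        intro x hx
        linarith [dist_triangle y x x₀, hTd x hx]
      refine (hΦ.sum_le (by positivity) h2).trans ?_
      have h3 : ((3 * L) ^ (d - 1))⁻¹ ≤ 1 / 9 * (L ^ (d - 1))⁻¹ := by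
        rw [mul_pow, mul_inv]
        have : ((3 : ℝ) ^ (d - 1))⁻¹ ≤ 1 / 9 := by
          rw [one_div]
          gcongr
          calc (9 : ℝ) = 3 ^ 2 := by norm_num
            _ ≤ 3 ^ (d - 1) := pow_le_pow_right₀ (by norm_num) (by omega)
        gcongr
      calc 3 / 2 * (T.card * ((3 * L) ^ (d - 1))⁻¹)
          ≤ 3 / 2 * (T.card * (1 / 9 * (L ^ (d - 1))⁻¹)) := by gcongr
        _ = a + 0 * W y := by rw [ha]; ring
    · right
      refine ⟨4 * L - dist y x₀, by linarith, fun z hz hzy => ⟨?_, hz⟩⟩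
      exact Metric.mem_closedBall.2 (by linarith [dist_triangle z y x₀])

/-- A nonnegative exterior solution with a small value far out which is large at a point of larger
norm grows near that point by a definite factor. -/
theorem growth_step (hd : 3 ≤ d) (hΦ : IsPoleKernel n η Φ) (hW : IsBarrier n η α W)
    {r₀ t κ M : ℝ} (hr₀ : 0 < r₀) (hu : IsFrameSol n η (farHalf n r₀) u)
    (hu0 : ∀ y ∈ farHalf n r₀, 0 ≤ u y) {ys x₀ : EuclideanSpace ℝ (Fin d)} (hys : ys ∈ farHalf n r₀)
    (hfar : 24 * 6 ^ (d - 1) * r₀ ^ α ≤ ‖ys‖ ^ α) (hx₀n : 0 ≤ x₀ n) (hyx : ‖ys‖ ≤ ‖x₀‖)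
    (hx₀ : 4 * r₀ ≤ ‖x₀‖) (hκ : 0 < κ) (hdκ : 8 * (d * κ) ≤ 1) (ht : 0 < t) (htκ : t ≤ κ * ‖x₀‖)
    (hux₀ : 4 * t ≤ u x₀)
    (hM : ∀ y, 0 ≤ y n → dist y x₀ ≤ 4 * (d * (κ * ‖x₀‖)) → u y ≤ M)
    (hty : (2 + 24 * 2 ^ d * 3 ^ (d - 1) * latticeConst d / κ ^ (d - 1)) * u ys < t) :
    u x₀ ≤ (1 - (18 * 2 ^ d * d ^ (d - 1) * latticeConst d)⁻¹) * M := by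
  obtain ⟨S, hSn, hSd, hSc, hSpot⟩ := exists_lattice_potential_le (by omega : 1 ≤ d) x₀
    (ℓ := κ * ‖x₀‖) (h := t / 2) (by positivity) (by linarith)
  rw [mul_div_cancel₀ _ two_ne_zero] at hSc
  have hpot : ∀ T ⊆ S, ∀ y, (∀ x ∈ T, t / 2 ≤ dist y x) → ∑ x ∈ T, Φ (y - x) ≤
      3 / 2 * latticeConst d * (κ * ‖x₀‖ / (t / 2) ^ d) := by
    intro T hT y hy
    calc ∑ x ∈ T, Φ (y - x) ≤ ∑ x ∈ T, 3 / 2 * (dist y x ^ (d - 1))⁻¹ := by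
          refine Finset.sum_le_sum fun x hx => ?_
          have h1 : 0 < dist y x := lt_of_lt_of_le (by positivity) (hy x hx)
          rw [dist_eq_norm] at h1 ⊢
          exact hΦ.upper _ (norm_pos_iff.1 h1)
      _ ≤ 3 / 2 * (latticeConst d * (κ * ‖x₀‖ / (t / 2) ^ d)) := by
          rw [← Finset.mul_sum]
          exact mul_le_mul_of_nonneg_left (hSpot T hT y hy) (by norm_num)
      _ = _ := by ring
  have hcard : ((S.filter fun x => t ≤ u x).card : ℝ) + (S.filter fun x => ¬ t ≤ u x).card =
      S.card := by
    exact_mod_cast Finset.card_filter_add_card_filter_not (s := S) fun x => t ≤ u x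
  have hSn' : ∀ x ∈ S, 0 ≤ x n := fun x hx => hx₀n.trans (hSn x hx n)
  rcases le_total ((S.filter fun x => ¬ t ≤ u x).card : ℝ) (S.filter fun x => t ≤ u x).card
    with h | h
  · refine absurd (le_of_many_large hd hΦ hW hr₀ hu hu0 hys hfar hyx hx₀ hκ hdκ ht htκ
      (T := S.filter fun x => t ≤ u x) (fun x hx => hSn' x (Finset.mem_filter.1 hx).1)
      (fun x hx => hSd x (Finset.mem_filter.1 hx).1) (fun x hx => (Finset.mem_filter.1 hx).2)
      (by linarith) (hpot _ (Finset.filter_subset _ _))) (not_le.2 hty)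
  · exact le_of_many_small hd hΦ hW hr₀ hu hx₀n hx₀ hκ hdκ ht htκ hux₀ hM
      (T := S.filter fun x => ¬ t ≤ u x) (fun x hx => hSn' x (Finset.mem_filter.1 hx).1)
      (fun x hx => hSd x (Finset.mem_filter.1 hx).1)
      (fun x hx => not_le.1 (Finset.mem_filter.1 hx).2)
      (by linarith) (hpot _ (Finset.filter_subset _ _))

end

section

variable {d : ℕ} {n : Fin d} {η α : ℝ} {Φ W u : EuclideanSpace ℝ (Fin d) → ℝ}

/-- Comparison of an exterior solution with a multiple of the barrier on a half annulus. -/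
theorem IsFrameSol.nonneg_add_barrier (hW : IsBarrier n η α W) {r ρ a : ℝ} (hr : 0 < r)
    (hu : IsFrameSol n η (farHalf n r) u) (ha : 0 < a)
    (hin : ∀ y, 0 ≤ y n → ‖y‖ = r → 0 ≤ u y + a * W y)
    (hout : ∀ y, 0 ≤ y n → ‖y‖ = ρ → 0 ≤ u y + a * W y) :
    ∀ y ∈ farHalf n r, ‖y‖ ≤ ρ → 0 ≤ u y + a * W y := by
  have hne : ∀ y ∈ farHalf n r, y ≠ 0 := fun y hy => norm_pos_iff.1 (hr.trans_le hy.2)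
  have key := nonneg_of_strict_supersolution (n := n) (f := fun y => u y + a * W y)
    (isCompact_halfAnnulus n r ρ) ?_ ?_
  · exact fun y hy hyρ => key y ⟨hy.1, hy.2, hyρ⟩
  · refine (hu.cont.mono fun y hy => ⟨hy.1, hy.2.1⟩).add (continuousOn_const.mul fun y hy => ?_)
    exact (hW.cont y (hne y ⟨hy.1, hy.2.1⟩)).continuousWithinAt
  · rintro y ⟨hyn, hyr, hyρ⟩ hneg
    refine ⟨hyn, ?_, ?_⟩
    · have h1 : r < ‖y‖ := hyr.lt_of_ne fun h => (hin y hyn h.symm).not_gt hneg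
      have h2 : ‖y‖ < ρ := hyρ.lt_of_ne fun h => (hout y hyn h).not_gt hneg
      refine ⟨min (‖y‖ - r) (ρ - ‖y‖), lt_min (by linarith) (by linarith), fun z hz hzy => ?_⟩
      rw [dist_eq_norm] at hzy
      have h3 := abs_lt.1 ((abs_norm_sub_norm_le z y).trans_lt hzy)
      have h4 := min_le_left (‖y‖ - r) (ρ - ‖y‖)
      have h5 := min_le_right (‖y‖ - r) (ρ - ‖y‖)
      exact ⟨hz, by linarith [h3.1], by linarith [h3.2]⟩
    · obtain ⟨w, ν, hwν, ho⟩ := hu.op y ⟨hyn, hyr⟩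
      obtain ⟨c, hc, hWc⟩ := hW.op w ν hwν y (hne y ⟨hyn, hyr⟩)
      exact ⟨w, ν, 0 + a * c, hwν.normal, by nlinarith, ho.add (hWc.const_mul a)⟩

theorem exists_mem_farHalf (n : Fin d) (r : ℝ) : ∃ y ∈ farHalf n r, ‖y‖ = max r 0 := by
  have h : ‖EuclideanSpace.single n (max r 0)‖ = max r 0 := by simp
  exact ⟨EuclideanSpace.single n (max r 0), ⟨by simp, by rw [h]; exact le_max_left _ _⟩, h⟩

/-- An exterior solution grows at most linearly. -/
theorem IsFrameSol.exists_le_add_norm {r : ℝ} (hr : 0 < r) (hu : IsFrameSol n η (farHalf n r) u) :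
    ∃ B, ∀ y ∈ farHalf n r, u y ≤ B + ‖y‖ := by
  obtain ⟨B, hB⟩ := (isCompact_halfAnnulus n r r).bddAbove_image
    (hu.cont.mono fun y hy => ⟨hy.1, hy.2.1⟩)
  refine ⟨B, fun y hy => ?_⟩
  have hy0 : 0 < ‖y‖ := hr.trans_le hy.2
  set z : EuclideanSpace ℝ (Fin d) := (r / ‖y‖) • y with hz
  have hs1 : r / ‖y‖ ≤ 1 := (div_le_one hy0).2 hy.2
  have hznorm : ‖z‖ = r := by
    rw [hz, norm_smul, Real.norm_of_nonneg (by positivity), div_mul_cancel₀ _ hy0.ne']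
  have hzn : 0 ≤ z n := by
    have := hy.1
    rw [hz, PiLp.smul_apply, smul_eq_mul]
    positivity
  have hseg : segment ℝ y z ⊆ farHalf n r := by
    rintro x ⟨a, b, ha, hb, hab, rfl⟩
    have h1 : a • y + b • z = (a + b * (r / ‖y‖)) • y := by rw [hz, smul_smul, add_smul]
    rw [h1]
    have h2 : 0 ≤ a + b * (r / ‖y‖) := by positivity
    refine ⟨?_, ?_⟩
    · have := hy.1
      rw [PiLp.smul_apply, smul_eq_mul]
      positivity
    · rw [norm_smul, Real.norm_of_nonneg h2, add_mul, mul_assoc, div_mul_cancel₀ _ hy0.ne']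
      nlinarith [hy.2]
  have h1 := (abs_le.1 (hu.lip y hy z ⟨hzn, hznorm.ge⟩ hseg)).2
  have h2 : u z ≤ B := hB ⟨z, ⟨hzn, hznorm.ge, hznorm.le⟩, rfl⟩
  have h3 : dist y z = ‖y‖ - r := by
    have : y - z = (1 - r / ‖y‖) • y := by rw [hz, sub_smul, one_smul]
    rw [dist_eq_norm, this, norm_smul, Real.norm_of_nonneg (by linarith), sub_mul, one_mul,
      div_mul_cancel₀ _ hy0.ne']
  linarith

/-- The factor of growth in `growth_step`. -/
def growthConst (d : ℕ) : ℝ := (18 * 2 ^ d * d ^ (d - 1) * latticeConst d)⁻¹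

theorem growthConst_pos (hd : 3 ≤ d) : 0 < growthConst d := by
  have := latticeConst_pos d
  have : (0 : ℝ) < d := by exact_mod_cast (by omega : 0 < d)
  unfold growthConst
  positivity

theorem growthConst_lt_one (hd : 3 ≤ d) : growthConst d < 1 := by
  have h1 : (1 : ℝ) ≤ d := by exact_mod_cast (by omega : 1 ≤ d)
  have h2 : (1 : ℝ) ≤ d ^ (d - 1) := one_le_pow₀ h1
  have h3 : (1 : ℝ) ≤ 2 ^ d := one_le_pow₀ (by norm_num)
  have h4 : 1 ≤ latticeConst d := by
    unfold latticeConst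
    have h5 : (1 : ℝ) ≤ 3 ^ d := one_le_pow₀ (by norm_num)
    have h6 : (1 : ℝ) ≤ 2 ^ (d + 1) := one_le_pow₀ (by norm_num)
    have h7 : (0 : ℝ) ≤ d ^ d := by positivity
    nlinarith
  refine inv_lt_one_of_one_lt₀ ?_
  calc (1 : ℝ) < 18 * 1 * 1 * 1 := by norm_num
    _ ≤ 18 * 2 ^ d * d ^ (d - 1) * latticeConst d := by gcongr

/-- The constant in the smallness condition of `eventually_lt_of_small`. -/
def smallConst (d : ℕ) : ℝ :=
  2 + 24 * 2 ^ d * 3 ^ (d - 1) * latticeConst d / (growthConst d / (8 * d)) ^ (d - 1)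

theorem smallConst_pos (hd : 3 ≤ d) : 0 < smallConst d := by
  have := latticeConst_pos d
  have := growthConst_pos hd
  have : (0 : ℝ) < d := by exact_mod_cast (by omega : 0 < d)
  unfold smallConst
  positivity

/-- If a function of at most linear growth can be increased by a factor `(1 - c)⁻¹` at the cost of
a relative change of radius of at most `c / 2`, it is small at large radii. -/
theorem exists_forall_lt_of_growth {E : Type*} {P : Set E} {N u : E → ℝ} {c s B R : ℝ} (hc0 : 0 < c)
    (hc1 : c < 1) (hs : 0 < s) (hR : 0 < R) (hB : ∀ x ∈ P, R / 2 ≤ N x → u x ≤ B + N x)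
    (hstep : ∀ x ∈ P, R ≤ N x → s ≤ u x → ∃ x' ∈ P, (1 - c / 2) * N x ≤ N x' ∧
      N x' ≤ (1 + c / 2) * N x ∧ (1 - c)⁻¹ * u x ≤ u x') :
    ∃ X, ∀ x ∈ P, X ≤ N x → u x < s := by
  have hg : 1 < (1 - c)⁻¹ := (one_lt_inv₀ (by linarith)).2 (by linarith)
  obtain ⟨K, hK⟩ := pow_unbounded_of_one_lt ((B + R) / s) hg
  rw [div_lt_iff₀ hs] at hK
  have hp0 : 0 < 1 - c / 2 := by linarith
  have hpK : 0 < (1 - c / 2) ^ K := by positivity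
  refine ⟨R / (1 - c / 2) ^ K, fun x₀ hx₀P hx₀ => ?_⟩
  by_contra! hux₀
  rw [div_le_iff₀ hpK] at hx₀
  have hN0 : 0 < N x₀ := by
    by_contra! h
    nlinarith
  have hseq : ∀ k : ℕ, ∃ x ∈ P, R ≤ N x ∧ (1 - c / 2) ^ k * N x₀ ≤ N x ∧
      N x ≤ (1 + c / 2) ^ k * N x₀ ∧ (1 - c)⁻¹ ^ k * s ≤ u x := by
    intro k
    induction k with
    | zero =>
      refine ⟨x₀, hx₀P, ?_, by simp, by simp, by simpa using hux₀⟩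
      have : (1 - c / 2) ^ K ≤ 1 := pow_le_one₀ hp0.le (by linarith)
      nlinarith
    | succ k ih =>
      obtain ⟨x, hxP, hxR, hlow, hup, hux⟩ := ih
      have hsu : s ≤ u x := (le_mul_of_one_le_left hs.le (one_le_pow₀ hg.le)).trans hux
      obtain ⟨x', hxP', hlow', hup', hux'⟩ := hstep x hxP hxR hsu
      have hlow2 : (1 - c / 2) ^ (k + 1) * N x₀ ≤ N x' := by
        refine le_trans ?_ hlow'
        rw [pow_succ', mul_assoc]
        exact mul_le_mul_of_nonneg_left hlow hp0.le
      have hux2 : (1 - c)⁻¹ ^ (k + 1) * s ≤ u x' := by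
        refine le_trans ?_ hux'
        rw [pow_succ', mul_assoc]
        exact mul_le_mul_of_nonneg_left hux (by linarith)
      have hup2 : N x' ≤ (1 + c / 2) ^ (k + 1) * N x₀ := by
        refine hup'.trans ?_
        rw [pow_succ', mul_assoc]
        exact mul_le_mul_of_nonneg_left hup (by linarith)
      refine ⟨x', hxP', ?_, hlow2, hup2, hux2⟩
      by_contra! hlt
      rcases le_total (k + 1) K with h | h
      · have h1 : (1 - c / 2) ^ K ≤ (1 - c / 2) ^ (k + 1) :=
          pow_le_pow_of_le_one hp0.le (by linarith) h
        have h2 := mul_le_mul_of_nonneg_right h1 hN0.le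
        linarith
      · have h1 : (1 - c)⁻¹ ^ K ≤ (1 - c)⁻¹ ^ (k + 1) := pow_le_pow_right₀ hg.le h
        have h2 := hB x' hxP' (by nlinarith)
        have h3 := mul_le_mul_of_nonneg_right h1 hs.le
        linarith
  have hq : 1 < (1 - c)⁻¹ / (1 + c / 2) := by
    rw [lt_div_iff₀ (by positivity), one_mul, inv_eq_one_div, lt_div_iff₀ (by linarith)]
    nlinarith
  obtain ⟨k, hk⟩ := pow_unbounded_of_one_lt ((|B| + N x₀) / s) hq
  have hqk : 0 < (1 + c / 2) ^ k := by positivity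
  rw [div_lt_iff₀ hs, div_pow, div_mul_eq_mul_div, lt_div_iff₀ hqk] at hk
  obtain ⟨x, hxP, hxR, -, hup, hux⟩ := hseq k
  have h1 := hB x hxP (by linarith)
  have h2 : (1 : ℝ) ≤ (1 + c / 2) ^ k := one_le_pow₀ (by linarith)
  have h3 := le_mul_of_one_le_right (abs_nonneg B) h2
  linarith [le_abs_self B]

/-- A nonnegative exterior solution which is small at one point far out is small near infinity. -/
theorem eventually_lt_of_small (hd : 3 ≤ d) (hΦ : IsPoleKernel n η Φ) (hW : IsBarrier n η α W)
    {r₀ t : ℝ} (hr₀ : 0 < r₀) (hu : IsFrameSol n η (farHalf n r₀) u)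
    (hu0 : ∀ y ∈ farHalf n r₀, 0 ≤ u y) {ys : EuclideanSpace ℝ (Fin d)} (hys : ys ∈ farHalf n r₀)
    (hfar : 24 * 6 ^ (d - 1) * r₀ ^ α ≤ ‖ys‖ ^ α) (ht : 0 < t) (hty : smallConst d * u ys < t) :
    ∃ X, ∀ y, 0 ≤ y n → X ≤ ‖y‖ → u y < 4 * t := by
  have hc0 := growthConst_pos hd
  have hc1 := growthConst_lt_one hd
  have hdpos : (0 : ℝ) < d := by exact_mod_cast (by omega : 0 < d)
  obtain ⟨κ, hκdef⟩ : ∃ κ, κ = growthConst d / (8 * d) := ⟨_, rfl⟩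
  have hκ : 0 < κ := by rw [hκdef]; positivity
  have hdκ : 8 * (d * κ) = growthConst d := by rw [hκdef]; field_simp
  rw [smallConst, ← hκdef] at hty
  obtain ⟨B, hB⟩ := hu.exists_le_add_norm hr₀
  obtain ⟨R, hRys, hRr, hRt⟩ : ∃ R, ‖ys‖ ≤ R ∧ 4 * r₀ ≤ R ∧ t / κ ≤ R :=
    ⟨max ‖ys‖ (max (4 * r₀) (t / κ)), le_max_left _ _, (le_max_left _ _).trans (le_max_right _ _),
      (le_max_right _ _).trans (le_max_right _ _)⟩
  rw [div_le_iff₀ hκ] at hRt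
  refine exists_forall_lt_of_growth (P := {y : EuclideanSpace ℝ (Fin d) | 0 ≤ y n}) (N := norm)
    (B := B) hc0 hc1 (by positivity : 0 < 4 * t) (by linarith : 0 < R) (fun x hx hxR => hB x ⟨hx, by linarith⟩) ?_
  intro x hxn hxR hux
  have hsub : ∀ y, dist y x ≤ 4 * (d * (κ * ‖x‖)) →
      (1 - growthConst d / 2) * ‖x‖ ≤ ‖y‖ ∧ ‖y‖ ≤ (1 + growthConst d / 2) * ‖x‖ := by
    intro y hy
    rw [dist_eq_norm] at hy
    have h1 := abs_le.1 ((abs_norm_sub_norm_le y x).trans hy)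
    have h2 : 4 * (d * (κ * ‖x‖)) = growthConst d / 2 * ‖x‖ := by linear_combination ‖x‖ / 2 * hdκ
    rw [h2] at h1
    constructor <;> linarith [h1.1, h1.2]
  have hcont : ContinuousOn u
      (Metric.closedBall x (4 * (d * (κ * ‖x‖))) ∩ {y : EuclideanSpace ℝ (Fin d) | 0 ≤ y n}) := by
    refine hu.cont.mono ?_
    rintro y ⟨hy, hyn⟩
    refine ⟨hyn, ?_⟩
    have h1 := (hsub y hy).1
    nlinarith [norm_nonneg x]
  obtain ⟨x', hx', hmax⟩ := ((isCompact_closedBall x (4 * (d * (κ * ‖x‖)))).inter_right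
    (isClosed_halfSpace n)).exists_isMaxOn
      ⟨x, Metric.mem_closedBall_self (by positivity), hxn⟩ hcont
  refine ⟨x', hx'.2, (hsub x' hx'.1).1, (hsub x' hx'.1).2, ?_⟩
  have h1 := growth_step hd hΦ hW hr₀ hu hu0 hys hfar hxn (hRys.trans hxR) (hRr.trans hxR) hκ
    (by linarith) ht (hRt.trans (by nlinarith)) hux
    (M := u x') (fun y hy hyx => hmax ⟨hyx, hy⟩) hty
  rw [inv_mul_le_iff₀ (by linarith)]
  exact h1

/-- An exterior solution which is bounded below has a limit at infinity. -/
theorem IsFrameSol.exists_limit (hd : 3 ≤ d) (hα : 0 < α) (hΦ : IsPoleKernel n η Φ)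
    (hW : IsBarrier n η α W) {r m : ℝ} (hr : 0 < r) (hu : IsFrameSol n η (farHalf n r) u)
    (hm : ∀ y ∈ farHalf n r, m ≤ u y) :
    ∃ L, ∀ ε > 0, ∃ X, ∀ y, 0 ≤ y n → X ≤ ‖y‖ → |u y - L| ≤ ε := by
  have hlarge : ∀ C : ℝ, ∃ X, r ≤ X ∧ C ≤ X ^ α := by
    intro C
    obtain ⟨X, h1, h2⟩ := ((tendsto_rpow_atTop hα).eventually_ge_atTop C |>.and
      (eventually_ge_atTop r)).exists
    exact ⟨X, h2, h1⟩
  set S : Set ℝ := {a | ∃ ρ, ∀ y ∈ farHalf n ρ, a ≤ u y} with hS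
  have hSne : S.Nonempty := ⟨m, r, hm⟩
  have hSbdd : BddAbove S := by
    obtain ⟨X, hXr, hX⟩ := hlarge (2 * (10 / 9 * r ^ α))
    obtain ⟨y₁, hy₁, hy₁X⟩ := exists_mem_farHalf n X
    rw [max_eq_left (hr.le.trans hXr)] at hy₁X
    have hy₁r : y₁ ∈ farHalf n r := ⟨hy₁.1, hXr.trans hy₁.2⟩
    refine ⟨m + 2 * (u y₁ - m), ?_⟩
    rintro a ⟨ρ, ha⟩
    have hm1 := hm y₁ hy₁r
    by_contra! hlt
    have ham : 0 < a - m := by linarith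
    have hrα : 0 < r ^ α := by positivity
    have key := ((hu.add_const (-a))).nonneg_add_barrier hW hr (ρ := max ρ X)
      (a := (a - m) * (10 / 9 * r ^ α)) (by positivity) ?_ ?_ y₁ hy₁r
      (by rw [hy₁X]; exact le_max_right _ _)
    · have h1 := hW.upper y₁ hy₁.1
      rw [hy₁X, Real.rpow_neg (by linarith)] at h1
      have h2 : 10 / 9 * r ^ α * W y₁ ≤ 1 / 2 := by
        have h3 : 0 < X ^ α := lt_of_lt_of_le (by positivity) hX
        calc 10 / 9 * r ^ α * W y₁ ≤ 10 / 9 * r ^ α * (X ^ α)⁻¹ := by gcongr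
          _ ≤ 1 / 2 := by
            rw [← div_eq_mul_inv, div_le_iff₀ h3]
            linarith
      nlinarith
    · intro y hyn hyr
      have h1 := hW.lower y (norm_pos_iff.1 (hyr ▸ hr))
      rw [hyr, Real.rpow_neg hr.le] at h1
      have h2 : 1 ≤ 10 / 9 * r ^ α * W y := by
        calc 1 = 10 / 9 * r ^ α * (9 / 10 * (r ^ α)⁻¹) := by field_simp
          _ ≤ _ := by gcongr
      have h3 := hm y ⟨hyn, hyr.ge⟩
      nlinarith
    · intro y hyn hyρ
      have h0 : 0 < ‖y‖ := by rw [hyρ]; exact lt_of_lt_of_le (by linarith) (le_max_right _ _)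
      have h1 := hW.pos (norm_pos_iff.1 h0)
      have h2 := ha y ⟨hyn, by rw [hyρ]; exact le_max_left _ _⟩
      have h3 : 0 ≤ (a - m) * (10 / 9 * r ^ α) * W y := by positivity
      linarith
  refine ⟨sSup S, fun ε hε => ?_⟩
  set L := sSup S with hL
  have hc := smallConst_pos hd
  set e := ε / (16 * (smallConst d + 1)) with he
  have he0 : 0 < e := by positivity
  have heε : e * (16 * (smallConst d + 1)) = ε := by rw [he]; field_simp
  obtain ⟨a, ⟨ρ, ha⟩, haL⟩ := exists_lt_of_lt_csSup hSne (by linarith : L - e < L)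
  set r₁ := max ρ r with hr₁
  have hr₁0 : 0 < r₁ := hr.trans_le (le_max_right _ _)
  have hsub : farHalf n r₁ ⊆ farHalf n r := fun y hy => ⟨hy.1, (le_max_right _ _).trans hy.2⟩
  have hnn : ∀ y ∈ farHalf n r₁, L - e ≤ u y := fun y hy =>
    haL.le.trans (ha y ⟨hy.1, (le_max_left _ _).trans hy.2⟩)
  obtain ⟨X, hX1, hX2⟩ : ∃ X, r₁ ≤ X ∧ 24 * 6 ^ (d - 1) * r₁ ^ α ≤ X ^ α := by
    obtain ⟨X, h1, h2⟩ := ((tendsto_rpow_atTop hα).eventually_ge_atTop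
      (24 * 6 ^ (d - 1) * r₁ ^ α) |>.and (eventually_ge_atTop r₁)).exists
    exact ⟨X, h2, h1⟩
  obtain ⟨ys, hys, hyL⟩ : ∃ ys ∈ farHalf n X, u ys < L + e := by
    by_contra! h
    linarith [le_csSup hSbdd ⟨X, h⟩]
  have hys1 : ys ∈ farHalf n r₁ := ⟨hys.1, hX1.trans hys.2⟩
  obtain ⟨Y, hY⟩ := eventually_lt_of_small hd hΦ hW hr₁0 ((hu.mono hsub).add_const (-(L - e)))
    (fun y hy => by linarith [hnn y hy]) hys1
    (hX2.trans (Real.rpow_le_rpow (hr₁0.le.trans hX1) hys.2 hα.le))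
    (t := (smallConst d + 1) * (2 * e)) (by positivity)
    (by nlinarith [hnn ys hys1])
  refine ⟨max r₁ Y, fun y hyn hy => ?_⟩
  have h1 := hnn y ⟨hyn, (le_max_left _ _).trans hy⟩
  have h2 := hY y hyn ((le_max_right _ _).trans hy)
  rw [abs_le]
  constructor <;> nlinarith

/-- Lower bound for an exterior solution that is asymptotically nonnegative. -/
theorem IsFrameSol.neg_rpow_le (hα : 0 < α) (hW : IsBarrier n η α W) {M : ℝ}
    (hu : IsFrameSol n η (farHalf n 1) u) (hM0 : 0 ≤ M)
    (hM : ∀ y, 0 ≤ y n → ‖y‖ = 1 → -M ≤ u y)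
    (hlim : ∀ ε > 0, ∃ X, ∀ y, 0 ≤ y n → X ≤ ‖y‖ → -ε ≤ u y) :
    ∀ y ∈ farHalf n 1, -u y ≤ 10 / 9 * M * ‖y‖ ^ (-α) := by
  intro y hy
  have hy0 : 0 < ‖y‖ := zero_lt_one.trans_le hy.2
  refine le_of_forall_pos_le_add fun ε hε => ?_
  obtain ⟨X, hX⟩ := hlim (ε / 2) (by positivity)
  have key := ((hu.add_const (ε / 2))).nonneg_add_barrier hW one_pos (ρ := max X ‖y‖)
    (a := 10 / 9 * M + ε / 2) (by positivity) ?_ ?_ y hy (le_max_right _ _)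
  · have h1 := hW.upper y hy.1
    have h2 : ‖y‖ ^ (-α) ≤ 1 := Real.rpow_le_one_of_one_le_of_nonpos hy.2 (by linarith)
    have h3 := mul_le_mul_of_nonneg_left h1 (by positivity : 0 ≤ 10 / 9 * M + ε / 2)
    nlinarith
  · intro z hzn hz
    have h1 := hW.lower z (norm_pos_iff.1 (by rw [hz]; exact one_pos))
    rw [hz, Real.one_rpow] at h1
    have h2 := hM z hzn hz
    nlinarith
  · intro z hzn hz
    have h1 := hX z hzn (by rw [hz]; exact le_max_left _ _)
    have h0 : 0 < ‖z‖ := by rw [hz]; exact lt_of_lt_of_le hy0 (le_max_right _ _)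
    have h2 := hW.pos (norm_pos_iff.1 h0)
    have h3 : 0 ≤ (10 / 9 * M + ε / 2) * W z := by positivity
    linarith

end

theorem IsFrameSol.mono_frame {d : ℕ} {n : Fin d} {η η' : ℝ} {U : Set (EuclideanSpace ℝ (Fin d))}
    {u : EuclideanSpace ℝ (Fin d) → ℝ} (h : IsFrameSol n η U u) (hη : η ≤ η') :
    IsFrameSol n η' U u := by
  refine ⟨h.cont, fun y hy => ?_, h.lip⟩
  obtain ⟨w, ν, hw, ho⟩ := h.op y hy
  exact ⟨w, ν, hw.mono hη, ho⟩

theorem tendsto_farFilter_iff {d : ℕ} (hd : 0 < d) {v : EuclideanSpace ℝ (Fin d) → ℝ} {L : ℝ} :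
    Tendsto v (farFilter d hd) (nhds L) ↔
      ∀ ε > 0, ∃ X, ∀ y, 0 ≤ y (lastIdx d hd) → X ≤ ‖y‖ → |v y - L| ≤ ε := by
  have hbasis : (farFilter d hd).HasBasis (fun _ : ℝ => True)
      fun X => (fun y => ‖y‖) ⁻¹' Ici X ∩ extDom d hd :=
    (atTop_basis.comap _).inf_principal _
  rw [hbasis.tendsto_iff Metric.nhds_basis_closedBall]
  refine forall₂_congr fun ε _ => ⟨?_, ?_⟩
  · rintro ⟨X, -, hX⟩
    refine ⟨max X 1, fun y hyn hy => ?_⟩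
    exact hX y ⟨(le_max_left _ _).trans hy, hyn, (le_max_right _ _).trans hy⟩
  · rintro ⟨X, hX⟩
    exact ⟨X, trivial, fun y hy => hX y hy.2.1 hy.1⟩

/-- Exterior solutions with a limit at infinity approach it at the rate of the barrier. -/
theorem IsFrameSol.rpow_mul_abs_sub_le {d : ℕ} {n : Fin d} {η α : ℝ}
    {W u : EuclideanSpace ℝ (Fin d) → ℝ} (hα : 1 / 2 ≤ α) (hW : IsBarrier n η α W)
    (hu : IsFrameSol n η (farHalf n 1) u) {L : ℝ}
    (hL : ∀ ε > 0, ∃ X, ∀ y, 0 ≤ y n → X ≤ ‖y‖ → |u y - L| ≤ ε) :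
    ∀ y ∈ farHalf n 1, ‖y‖ ^ α * |u y - L| ≤
      6 * (sSup (u '' {y | 0 ≤ y n ∧ 1 ≤ ‖y‖ ∧ ‖y‖ ≤ 2}) -
        sInf (u '' {y | 0 ≤ y n ∧ 1 ≤ ‖y‖ ∧ ‖y‖ ≤ 2})) := by
  have hα0 : 0 < α := by linarith
  set K : Set (EuclideanSpace ℝ (Fin d)) := {y | 0 ≤ y n ∧ 1 ≤ ‖y‖ ∧ ‖y‖ ≤ 2} with hK
  have hKc : IsCompact K := isCompact_halfAnnulus n 1 2
  have hcK : ContinuousOn u K := hu.cont.mono fun y hy => ⟨hy.1, hy.2.1⟩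
  have hosc : ∀ y ∈ K, ∀ z ∈ K, |u y - u z| ≤ sSup (u '' K) - sInf (u '' K) := by
    intro y hy z hz
    have h1 := le_csSup (hKc.bddAbove_image hcK) (mem_image_of_mem u hy)
    have h2 := le_csSup (hKc.bddAbove_image hcK) (mem_image_of_mem u hz)
    have h3 := csInf_le (hKc.bddBelow_image hcK) (mem_image_of_mem u hy)
    have h4 := csInf_le (hKc.bddBelow_image hcK) (mem_image_of_mem u hz)
    rw [abs_le]
    constructor <;> linarith
  set S : Set (EuclideanSpace ℝ (Fin d)) := {y | 0 ≤ y n ∧ 1 ≤ ‖y‖ ∧ ‖y‖ ≤ 1} with hS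
  have hSK : S ⊆ K := fun y hy => ⟨hy.1, hy.2.1, hy.2.2.trans one_le_two⟩
  obtain ⟨y₁, hy₁, hy₁1⟩ := exists_mem_farHalf n 1
  rw [max_eq_left zero_le_one] at hy₁1
  obtain ⟨z₁, hz₁, hmax⟩ := (isCompact_halfAnnulus n 1 1).exists_isMaxOn
    ⟨y₁, hy₁.1, hy₁.2, hy₁1.le⟩ ((hcK.mono hSK).sub (continuousOn_const (c := L))).abs
  set M := |u z₁ - L| with hM
  have hM0 : 0 ≤ M := abs_nonneg _
  have hbound : ∀ y, 0 ≤ y n → ‖y‖ = 1 → |u y - L| ≤ M := fun y hyn hy =>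
    hmax (show y ∈ S from ⟨hyn, hy.ge, hy.le⟩)
  have hrate : ∀ y ∈ farHalf n 1, |u y - L| ≤ 10 / 9 * M * ‖y‖ ^ (-α) := by
    intro y hy
    have h1 := (hu.add_const (-L)).neg_rpow_le hα0 hW hM0
      (fun z hzn hz => by linarith [(abs_le.1 (hbound z hzn hz)).1])
      (fun ε hε => (hL ε hε).imp fun X hX z hzn hz => by linarith [(abs_le.1 (hX z hzn hz)).1]) y hy
    have h2 := (hu.neg.add_const L).neg_rpow_le hα0 hW hM0
      (fun z hzn hz => by linarith [(abs_le.1 (hbound z hzn hz)).2])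
      (fun ε hε => (hL ε hε).imp fun X hX z hzn hz => by linarith [(abs_le.1 (hX z hzn hz)).2]) y hy
    rw [abs_le]
    constructor <;> linarith
  have hMosc : M ≤ 5 * (sSup (u '' K) - sInf (u '' K)) := by
    obtain ⟨y₂, hy₂, hy₂2⟩ := exists_mem_farHalf n 2
    rw [max_eq_left zero_le_two] at hy₂2
    have h1 := hrate y₂ ⟨hy₂.1, by rw [hy₂2]; exact one_le_two⟩
    have h2 : (2 : ℝ) ^ (-α) ≤ 18 / 25 := by
      calc (2 : ℝ) ^ (-α) ≤ 2 ^ (-(1 / 2) : ℝ) :=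
            Real.rpow_le_rpow_of_exponent_le one_le_two (by linarith)
        _ = (√2)⁻¹ := by rw [Real.rpow_neg zero_le_two, Real.sqrt_eq_rpow]
        _ ≤ (25 / 18)⁻¹ := by
            gcongr
            exact Real.le_sqrt_of_sq_le (by norm_num)
        _ = 18 / 25 := by norm_num
    have h3 := hosc z₁ (hSK hz₁) y₂ ⟨hy₂.1, by rw [hy₂2]; exact one_le_two, hy₂2.le⟩
    rw [hy₂2] at h1
    have h4 : |u y₂ - L| ≤ 4 / 5 * M := h1.trans (by nlinarith)
    have h5 := _root_.abs_sub_le (u z₁) (u y₂) L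
    linarith
  intro y hy
  have hy0 : 0 < ‖y‖ := zero_lt_one.trans_le hy.2
  calc ‖y‖ ^ α * |u y - L| ≤ ‖y‖ ^ α * (10 / 9 * M * ‖y‖ ^ (-α)) := by
        gcongr
        exact hrate y hy
    _ = 10 / 9 * M := by
        rw [Real.rpow_neg hy0.le]
        field_simp
    _ ≤ 6 * (sSup (u '' K) - sInf (u '' K)) := by linarith

/-- Quantitative convergence rate to the limit at infinity for one-sided bounded exterior
solutions in `d ≥ 3`. -/
theorem stmt7 (d : ℕ) (hd : 3 ≤ d) (δ : ℝ) (hδ : 0 < δ) :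
    ∃ η₀ : ℝ, 0 < η₀ ∧ ∃ C : ℝ, 0 < C ∧
      ∀ v : EuclideanSpace ℝ (Fin d) → ℝ,
        IsHodSol d (by omega) v (extDom d (by omega)) →
        (∀ y ∈ extDom d (by omega), ‖fderiv ℝ v y‖ ≤ η₀) →
        ((∃ M : ℝ, ∀ y ∈ extDom d (by omega), v y ≤ M) ∨
         (∃ m : ℝ, ∀ y ∈ extDom d (by omega), m ≤ v y)) →
        ∃ L : ℝ, Filter.Tendsto v (farFilter d (by omega)) (nhds L) ∧
          ∀ y ∈ extDom d (by omega),
            ‖y‖ ^ ((d : ℝ) - 2 - δ) * |v y - L| ≤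
              C * (sSup (v '' halfAnn d (by omega) 2) - sInf (v '' halfAnn d (by omega) 2)) := by
  have hd0 : 0 < d := by omega
  have hd3 : (3 : ℝ) ≤ d := by exact_mod_cast hd
  have hδ' : 0 < min δ (1 / 2) := by positivity
  have hδ2 := min_le_right δ (1 / 2)
  obtain ⟨η, hη, hker⟩ := exists_kernels (d := d) (α := (d : ℝ) - 2 - min δ (1 / 2)) (by omega)
    (by linarith) (by linarith)
  obtain ⟨Φ, W, hΦ, hW⟩ := hker (lastIdx d hd0)
  have hmin : 0 < min (1 / 2) (η / (d + 2)) := by positivity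
  refine ⟨min (1 / 2) (η / (d + 2)), hmin, 6, by norm_num, fun v hv hgrad hbdd => ?_⟩
  have hu : IsFrameSol (lastIdx d hd0) η (farHalf (lastIdx d hd0) 1) v := by
    refine (hv.isFrameSol (min_le_left _ _) hgrad).mono_frame ?_
    have h1 := min_le_right (1 / 2) (η / ((d : ℝ) + 2))
    rw [le_div_iff₀ (by positivity)] at h1
    linarith
  obtain ⟨L, hL⟩ : ∃ L, ∀ ε > 0, ∃ X, ∀ y, 0 ≤ y (lastIdx d hd0) → X ≤ ‖y‖ → |v y - L| ≤ ε := by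
    rcases hbdd with ⟨M, hM⟩ | ⟨m, hm⟩
    · obtain ⟨L, hL⟩ := hu.neg.exists_limit hd (by linarith) hΦ hW one_pos (m := -M)
        fun y hy => neg_le_neg (hM y hy)
      refine ⟨-L, fun ε hε => (hL ε hε).imp fun X hX y hyn hy => ?_⟩
      rw [← abs_neg]
      convert hX y hyn hy using 2
      ring
    · exact hu.exists_limit hd (by linarith) hΦ hW one_pos hm
  refine ⟨L, (tendsto_farFilter_iff hd0).2 hL, fun y hy => ?_⟩
  refine le_trans ?_ (hu.rpow_mul_abs_sub_le (by linarith) hW hL y hy)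
  gcongr
  · exact hy.2
  · exact min_le_left _ _
end
end

section
/- Let u be a continuous nonnegative function on the closed unit ball of ℝ^d which is a viscosity solution of the homogeneous Bernoulli problem in the open unit ball B₁, and suppose u(x) ≤ (x_d)₊ for all x ∈ B₁ and 0 ∈ ∂{u>0}. Then u(x) = (x_d)₊ for every x ∈ B₁. -/
open Real Set Filter Metric MeasureTheory

noncomputable section

/-- The Laplacian of `φ` at `x` (trace of the Hessian). -/
def lapl (d : ℕ) (φ : EuclideanSpace ℝ (Fin d) → ℝ) (x : EuclideanSpace ℝ (Fin d)) : ℝ :=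
  ∑ i : Fin d, hessC d φ x i i

/-- `u` is a continuous nonnegative viscosity supersolution of the Bernoulli free boundary
problem `Δu = 0` in `{u>0} ∩ U`, `|∇u| = Q` on `∂{u>0} ∩ U`. -/
def IsViscSupersol (d : ℕ) (U : Set (EuclideanSpace ℝ (Fin d)))
    (Q u : EuclideanSpace ℝ (Fin d) → ℝ) : Prop :=
  ContinuousOn u U ∧ (∀ x ∈ U, 0 ≤ u x) ∧
  ∀ φ : EuclideanSpace ℝ (Fin d) → ℝ, ContDiffOn ℝ (⊤ : ℕ∞) φ U →
    ∀ x ∈ U, IsLocalMinOn (fun z => u z - φ z) U x → u x = φ x →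
      lapl d φ x ≤ 0 ∨ (φ x = 0 ∧ ‖fderiv ℝ φ x‖ ≤ Q x)

/-- `u` is a continuous nonnegative viscosity subsolution of the Bernoulli free boundary
problem `Δu = 0` in `{u>0} ∩ U`, `|∇u| = Q` on `∂{u>0} ∩ U`. -/
def IsViscSubsol (d : ℕ) (U : Set (EuclideanSpace ℝ (Fin d)))
    (Q u : EuclideanSpace ℝ (Fin d) → ℝ) : Prop :=
  ContinuousOn u U ∧ (∀ x ∈ U, 0 ≤ u x) ∧
  ∀ φ : EuclideanSpace ℝ (Fin d) → ℝ, ContDiffOn ℝ (⊤ : ℕ∞) φ U →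
    ∀ x ∈ closure {z ∈ U | 0 < u z} ∩ U,
      IsLocalMaxOn (fun z => u z - max (φ z) 0) U x → u x = max (φ x) 0 →
      0 ≤ lapl d φ x ∨ (φ x = 0 ∧ Q x ≤ ‖fderiv ℝ φ x‖)

/-- `u` is a viscosity solution: both a subsolution and a supersolution. -/
def IsViscSol (d : ℕ) (U : Set (EuclideanSpace ℝ (Fin d)))
    (Q u : EuclideanSpace ℝ (Fin d) → ℝ) : Prop :=
  IsViscSubsol d U Q u ∧ IsViscSupersol d U Q u

open Topology

variable {d : ℕ}

theorem lapl_eq_sum {φ : EuclideanSpace ℝ (Fin d) → ℝ}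
    {φ' : EuclideanSpace ℝ (Fin d) → EuclideanSpace ℝ (Fin d) →L[ℝ] ℝ}
    {g : Fin d → EuclideanSpace ℝ (Fin d) →L[ℝ] ℝ} {x : EuclideanSpace ℝ (Fin d)}
    (hφ : ∀ z, HasFDerivAt φ (φ' z) z)
    (hg : ∀ i, HasFDerivAt (fun z => φ' z (EuclideanSpace.single i 1)) (g i) x) :
    lapl d φ x = ∑ i, g i (EuclideanSpace.single i 1) := by
  unfold lapl hessC
  refine Finset.sum_congr rfl fun i _ => ?_
  simp only [(hφ _).fderiv, (hg i).fderiv]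

theorem hasFDerivAt_coord (k : Fin d) (z : EuclideanSpace ℝ (Fin d)) :
    HasFDerivAt (fun z : EuclideanSpace ℝ (Fin d) => z k)
      (EuclideanSpace.proj k : EuclideanSpace ℝ (Fin d) →L[ℝ] ℝ) z :=
  (EuclideanSpace.proj k : EuclideanSpace ℝ (Fin d) →L[ℝ] ℝ).hasFDerivAt

theorem hasFDerivAt_gaussian (a : ℝ) (y z : EuclideanSpace ℝ (Fin d)) :
    HasFDerivAt (fun z : EuclideanSpace ℝ (Fin d) => exp (-a * ‖z - y‖ ^ 2))
      (exp (-a * ‖z - y‖ ^ 2) • ((-a) • (2 • innerSL ℝ (z - y)))) z := by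
  have h := (((hasFDerivAt_id z).sub_const y).norm_sq.const_mul (-a)).exp
  simpa using h

theorem lapl_gaussian_barrier (a m C : ℝ) (k : Fin d) (y p : EuclideanSpace ℝ (Fin d)) :
    lapl d (fun z => z k - m * exp (-a * ‖z - y‖ ^ 2) + C) p =
      2 * a * m * exp (-a * ‖p - y‖ ^ 2) * (d - 2 * a * ‖p - y‖ ^ 2) := by
  have hφ : ∀ z, HasFDerivAt
      (fun z : EuclideanSpace ℝ (Fin d) => z k - m * exp (-a * ‖z - y‖ ^ 2) + C)
      (EuclideanSpace.proj k - m • (exp (-a * ‖z - y‖ ^ 2) • ((-a) • (2 • innerSL ℝ (z - y))))) z :=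
    fun z => ((hasFDerivAt_coord k z).sub
      ((hasFDerivAt_gaussian a y z).const_mul m)).add_const C
  have hg : ∀ i, HasFDerivAt (fun z : EuclideanSpace ℝ (Fin d) =>
      ((EuclideanSpace.proj k : EuclideanSpace ℝ (Fin d) →L[ℝ] ℝ) -
        m • (exp (-a * ‖z - y‖ ^ 2) • ((-a) • (2 • innerSL ℝ (z - y)))))
        (EuclideanSpace.single i (1 : ℝ)))
      ((2 * a * m) • (exp (-a * ‖p - y‖ ^ 2) •
          (EuclideanSpace.proj i : EuclideanSpace ℝ (Fin d) →L[ℝ] ℝ) +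
        (p i - y i) • (exp (-a * ‖p - y‖ ^ 2) • ((-a) • (2 • innerSL ℝ (p - y)))))) p := by
    intro i
    have h := (((hasFDerivAt_gaussian a y p).mul
      ((hasFDerivAt_coord i p).sub_const (y i))).const_mul (2 * a * m)).const_add
        ((EuclideanSpace.single i (1 : ℝ) : EuclideanSpace ℝ (Fin d)) k)
    refine h.congr_of_eventuallyEq (Eventually.of_forall fun z => ?_)
    simp [EuclideanSpace.inner_single_right]
    ring
  rw [lapl_eq_sum hφ hg]
  have hterm : ∀ i : Fin d, ((2 * a * m) • (exp (-a * ‖p - y‖ ^ 2) •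
          (EuclideanSpace.proj i : EuclideanSpace ℝ (Fin d) →L[ℝ] ℝ) +
        (p i - y i) • (exp (-a * ‖p - y‖ ^ 2) • ((-a) • (2 • innerSL ℝ (p - y))))))
          (EuclideanSpace.single i 1) =
      2 * a * m * exp (-a * ‖p - y‖ ^ 2) * (1 - 2 * a * (p i - y i) ^ 2) := by
    intro i
    simp [EuclideanSpace.inner_single_right]
    ring
  rw [Finset.sum_congr rfl fun i _ => hterm i, ← Finset.mul_sum, Finset.sum_sub_distrib,
    ← Finset.mul_sum, EuclideanSpace.norm_sq_eq]
  simp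

theorem IsViscSubsol.lapl_nonneg {U : Set (EuclideanSpace ℝ (Fin d))}
    {Q u φ : EuclideanSpace ℝ (Fin d) → ℝ} (hu : IsViscSubsol d U Q u)
    (hφ : ContDiffOn ℝ (⊤ : ℕ∞) φ U) {x : EuclideanSpace ℝ (Fin d)} (hx : x ∈ U)
    (hpos : 0 < u x) (heq : u x = φ x) (hle : ∀ᶠ z in 𝓝[U] x, u z ≤ φ z) :
    0 ≤ lapl d φ x := by
  have hmax : u x = max (φ x) 0 := by rw [max_eq_left (heq ▸ hpos.le), heq]
  have hloc : IsLocalMaxOn (fun z => u z - max (φ z) 0) U x := by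
    filter_upwards [hle] with z hz
    rw [← hmax, sub_self]
    exact sub_nonpos.2 (hz.trans (le_max_left _ _))
  exact (hu.2.2 φ hφ x ⟨subset_closure ⟨hx, hpos⟩, hx⟩ hloc hmax).resolve_right
    fun h => hpos.ne' (heq.trans h.1)

theorem abs_coord_sub_le (k : Fin d) (x y : EuclideanSpace ℝ (Fin d)) :
    |x k - y k| ≤ ‖x - y‖ := by
  simpa using PiLp.norm_apply_le (x - y) k

theorem gaussian_sub_le {a R t : ℝ} (ha : 0 < a) (ht : 0 ≤ t) (htR : t ≤ R) :
    exp (-a * t ^ 2) - exp (-a * R ^ 2) ≤ 2 * a * R * (R - t) := by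
  have h1 : exp (-a * t ^ 2) ≤ 1 := exp_le_one_iff.2 (by nlinarith [sq_nonneg t])
  have h2 : exp (-a * R ^ 2) = exp (-a * t ^ 2) * exp (-(a * (R ^ 2 - t ^ 2))) := by
    rw [← exp_add]; ring_nf
  have h3 := add_one_le_exp (-(a * (R ^ 2 - t ^ 2)))
  have h4 : 0 ≤ a * (R ^ 2 - t ^ 2) := mul_nonneg ha.le (by nlinarith)
  have h5 : a * (R ^ 2 - t ^ 2) ≤ 2 * a * R * (R - t) := by
    nlinarith [mul_nonneg ha.le (sq_nonneg (R - t))]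
  rw [h2]
  nlinarith [exp_pos (-a * t ^ 2)]

theorem le_gaussian_sub {a R t : ℝ} (ha : 0 < a) (ht : 0 ≤ t) (htR : t ≤ R) :
    a * R * exp (-a * R ^ 2) * (R - t) ≤ exp (-a * t ^ 2) - exp (-a * R ^ 2) := by
  have h2 : exp (-a * t ^ 2) = exp (-a * R ^ 2) * exp (a * (R ^ 2 - t ^ 2)) := by
    rw [← exp_add]; ring_nf
  have h3 := add_one_le_exp (a * (R ^ 2 - t ^ 2))
  have h5 : a * R * (R - t) ≤ a * (R ^ 2 - t ^ 2) := by
    nlinarith [mul_nonneg ha.le (mul_nonneg ht (sub_nonneg.2 htR))]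
  rw [h2]
  nlinarith [exp_pos (-a * R ^ 2)]

/-- Quantitative Hopf lemma for a subsolution below `(x_k)₊`. -/
theorem IsViscSubsol.hopf {U : Set (EuclideanSpace ℝ (Fin d))}
    {Q u : EuclideanSpace ℝ (Fin d) → ℝ} (hu : IsViscSubsol d U Q u)
    (k : Fin d) (hup : ∀ x ∈ U, u x ≤ max (x k) 0)
    {r R m : ℝ} (hr : 0 < r) (hR : 0 < R) (hm : 0 < m) :
    ∃ c > 0, ∀ y : EuclideanSpace ℝ (Fin d), closedBall y R ⊆ U → R ≤ y k →
      (∀ z ∈ closedBall y r, z ∈ U → u z ≤ z k - m) →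
      ∀ z ∈ closedBall y R, u z ≤ z k - c * (R - ‖z - y‖) := by
  have hd : (0 : ℝ) < d := by exact_mod_cast k.pos
  set a : ℝ := d / r ^ 2 with ha_def
  have ha : 0 < a := by positivity
  have har : a * r ^ 2 = d := by rw [ha_def]; field_simp
  set m' : ℝ := min m (1 / (2 * a * R)) with hm'_def
  have hm' : 0 < m' := lt_min hm (by positivity)
  have hm'1 : m' * (2 * a * R) ≤ 1 := by
    rw [← le_div_iff₀ (by positivity)]; exact min_le_right _ _
  refine ⟨m' * (a * R * exp (-a * R ^ 2)), by positivity, fun y hyU hyR hin => ?_⟩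
  suffices h : ∀ z ∈ closedBall y R,
      u z ≤ z k - m' * (exp (-a * ‖z - y‖ ^ 2) - exp (-a * R ^ 2)) by
    intro z hz
    have hz' : ‖z - y‖ ≤ R := by simpa [dist_eq_norm] using hz
    have := mul_le_mul_of_nonneg_left (le_gaussian_sub ha (norm_nonneg (z - y)) hz') hm'.le
    linarith [h z hz]
  set b : EuclideanSpace ℝ (Fin d) → ℝ :=
    fun z => z k - m' * exp (-a * ‖z - y‖ ^ 2) + m' * exp (-a * R ^ 2) with hb
  have hbs : ContDiff ℝ (⊤ : ℕ∞) (fun z : EuclideanSpace ℝ (Fin d) =>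
      z k - m' * exp (-a * ‖z - y‖ ^ 2)) := by
    refine ContDiff.sub (EuclideanSpace.proj k : EuclideanSpace ℝ (Fin d) →L[ℝ] ℝ).contDiff ?_
    exact contDiff_const.mul
      (contDiff_const.mul ((contDiff_id.sub contDiff_const).norm_sq ℝ)).exp
  have hbc : Continuous b := hbs.continuous.add continuous_const
  obtain ⟨p, hp, hpmax⟩ := (isCompact_closedBall y R).exists_isMaxOn
    (nonempty_closedBall.2 hR.le) ((hu.1.mono hyU).sub hbc.continuousOn)
  have hle : ∀ z ∈ closedBall y R, u z - b z ≤ u p - b p := fun z hz => hpmax hz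
  suffices hneg : u p - b p ≤ 0 by
    intro z hz
    have := hle z hz
    simp only [hb] at this hneg
    linarith
  by_contra! hcon
  have hpR : ‖p - y‖ ≤ R := by simpa [dist_eq_norm] using hp
  have hpk : R - ‖p - y‖ ≤ p k := by
    have := abs_le.1 (abs_coord_sub_le k p y)
    linarith [this.1]
  have hupk : u p ≤ p k := by
    have h := hup p (hyU hp)
    rwa [max_eq_left (by linarith)] at h
  have hbp : b p = p k - m' * (exp (-a * ‖p - y‖ ^ 2) - exp (-a * R ^ 2)) := by
    simp only [hb]; ring
  have hgle := gaussian_sub_le ha (norm_nonneg (p - y)) hpR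
  have hlt : ‖p - y‖ < R := by
    refine lt_of_le_of_ne hpR fun h => ?_
    rw [hbp, h] at hcon
    linarith
  have hpr : r < ‖p - y‖ := by
    by_contra! h
    have h1 := hin p (by simpa [dist_eq_norm] using h) (hyU hp)
    have h2 : exp (-a * ‖p - y‖ ^ 2) ≤ 1 :=
      exp_le_one_iff.2 (by nlinarith [sq_nonneg ‖p - y‖])
    have h3 : m' ≤ m := min_le_left _ _
    have h4 := exp_pos (-a * R ^ 2)
    nlinarith
  have hpos : 0 < u p := by
    have h1 := mul_le_mul_of_nonneg_left hgle hm'.le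
    have h2 : 0 ≤ R - ‖p - y‖ := sub_nonneg.2 hpR
    nlinarith
  have hnhds : ∀ᶠ z in 𝓝[U] p, u z ≤
      z k - m' * exp (-a * ‖z - y‖ ^ 2) + (m' * exp (-a * R ^ 2) + (u p - b p)) := by
    refine nhdsWithin_le_nhds ?_
    filter_upwards [isOpen_ball.mem_nhds (show p ∈ ball y R by simpa [dist_eq_norm] using hlt)]
      with z hz
    have := hle z (ball_subset_closedBall hz)
    have hbz : b z = z k - m' * exp (-a * ‖z - y‖ ^ 2) + m' * exp (-a * R ^ 2) := rfl
    linarith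
  have hlap := hu.lapl_nonneg (hbs.add contDiff_const).contDiffOn (hyU hp) hpos
    (by rw [hbp]; ring) hnhds
  rw [lapl_gaussian_barrier] at hlap
  have h1 : (d : ℝ) - 2 * a * ‖p - y‖ ^ 2 < 0 := by
    have : r ^ 2 < ‖p - y‖ ^ 2 := by gcongr
    nlinarith
  have h2 : 0 < 2 * a * m' * exp (-a * ‖p - y‖ ^ 2) := by positivity
  nlinarith

/-- Strong maximum principle for `x_k - u` in the upper half ball. -/
theorem IsViscSubsol.lt_coord {Q u : EuclideanSpace ℝ (Fin d) → ℝ}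
    (hu : IsViscSubsol d (ball 0 1) Q u) (k : Fin d)
    (hup : ∀ x ∈ ball (0 : EuclideanSpace ℝ (Fin d)) 1, u x ≤ max (x k) 0)
    {x₀ : EuclideanSpace ℝ (Fin d)} (hx₀ : x₀ ∈ ball (0 : EuclideanSpace ℝ (Fin d)) 1)
    (hk₀ : 0 < x₀ k) (hlt : u x₀ < x₀ k) {x : EuclideanSpace ℝ (Fin d)}
    (hx : x ∈ ball (0 : EuclideanSpace ℝ (Fin d)) 1) (hk : 0 < x k) : u x < x k := by
  have hkc : Continuous fun z : EuclideanSpace ℝ (Fin d) => z k := by fun_prop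
  set P : Set (EuclideanSpace ℝ (Fin d)) := ball 0 1 ∩ {z | 0 < z k} with hP
  set V : Set (EuclideanSpace ℝ (Fin d)) := ball 0 1 ∩ (fun z => z k - u z) ⁻¹' Ioi 0 with hV
  have hPconn : IsPreconnected P :=
    ((convex_ball 0 1).inter (convex_halfSpace_gt
      (EuclideanSpace.proj k : EuclideanSpace ℝ (Fin d) →L[ℝ] ℝ).isLinear 0)).isPreconnected
  have hVo : IsOpen V := (hkc.continuousOn.sub hu.1).isOpen_inter_preimage isOpen_ball isOpen_Ioi
  have hsub : P ⊆ V := by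
    refine hPconn.subset_of_closure_inter_subset hVo
      ⟨x₀, ⟨hx₀, hk₀⟩, hx₀, sub_pos.2 hlt⟩ ?_
    rintro w ⟨hwV, hwb, hwk⟩
    refine ⟨hwb, ?_⟩
    obtain ⟨s, hs, hsb⟩ := Metric.isOpen_iff.1 isOpen_ball w hwb
    obtain ⟨R, hR, hRs, hRk⟩ : ∃ R : ℝ, 0 < R ∧ 2 * R ≤ s ∧ 2 * R ≤ w k := by
      refine ⟨min s (w k) / 2, half_pos (lt_min hs hwk), ?_, ?_⟩
      · linarith [min_le_left s (w k)]
      · linarith [min_le_right s (w k)]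
    obtain ⟨y, hyV, hyw⟩ := Metric.mem_closure_iff.1 hwV R hR
    rw [dist_eq_norm] at hyw
    obtain ⟨r, hr, hrV⟩ := Metric.nhds_basis_closedBall.mem_iff.1
      (((hkc.continuousOn.sub hu.1).isOpen_inter_preimage isOpen_ball
        (isOpen_Ioi (a := (y k - u y) / 2))).mem_nhds ⟨hyV.1, show (y k - u y) / 2 < y k - u y from half_lt_self hyV.2⟩)
    obtain ⟨c, hc, H⟩ := hu.hopf k hup hr hR (half_pos hyV.2)
    have h := H y ?_ ?_ ?_ w (by rw [mem_closedBall, dist_eq_norm]; exact hyw.le)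
    · have := mul_pos hc (sub_pos.2 hyw)
      change 0 < w k - u w
      linarith
    · refine Subset.trans (fun z hz => ?_) hsb
      rw [mem_closedBall, dist_eq_norm] at hz
      rw [mem_ball, dist_eq_norm]
      calc ‖z - w‖ = ‖(z - y) - (w - y)‖ := by congr 1; abel
        _ ≤ ‖z - y‖ + ‖w - y‖ := norm_sub_le _ _
        _ < s := by linarith
    · have := abs_le.1 (abs_coord_sub_le k w y)
      linarith [this.2]
    · intro z hz _
      have : (y k - u y) / 2 < z k - u z := (hrV hz).2
      linarith
  exact sub_pos.1 (hsub ⟨hx, hk⟩).2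

theorem IsViscSubsol.exists_slope_lt_one {Q u : EuclideanSpace ℝ (Fin d) → ℝ}
    (hu : IsViscSubsol d (ball 0 1) Q u) (k : Fin d)
    (hup : ∀ x ∈ ball (0 : EuclideanSpace ℝ (Fin d)) 1, u x ≤ max (x k) 0)
    (hlt : ∀ x ∈ ball (0 : EuclideanSpace ℝ (Fin d)) 1, 0 < x k → u x < x k) :
    ∃ c > 0, ∀ z : EuclideanSpace ℝ (Fin d), ‖z‖ < 1 / 8 → 0 ≤ z k → u z ≤ (1 - c) * z k := by
  have hkc : Continuous fun z : EuclideanSpace ℝ (Fin d) => z k := by fun_prop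
  set K : Set (EuclideanSpace ℝ (Fin d)) := closedBall 0 (3 / 4) ∩ {z | 1 / 8 ≤ z k} with hK
  have hKc : IsCompact K :=
    (isCompact_closedBall 0 (3 / 4)).inter_right (isClosed_le continuous_const hkc)
  have hKb : K ⊆ ball 0 1 := fun z hz => closedBall_subset_ball (by norm_num) hz.1
  obtain ⟨m, hm, hmK⟩ := hKc.exists_forall_le' (hkc.continuousOn.sub (hu.1.mono hKb))
    (a := 0) fun z hz => sub_pos.2 (hlt z (hKb hz) (lt_of_lt_of_le (by norm_num) hz.2))
  obtain ⟨c, hc, H⟩ := hu.hopf k hup (r := 1 / 8) (R := 1 / 4)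
    (by norm_num) (by norm_num) hm
  refine ⟨c, hc, fun z hz hzk => ?_⟩
  have hzk' : z k ≤ 1 / 8 := by
    have := abs_le.1 (abs_coord_sub_le k z 0)
    simp only [sub_zero, PiLp.zero_apply] at this
    linarith [this.2]
  set y : EuclideanSpace ℝ (Fin d) := z + EuclideanSpace.single k (1 / 4 - z k) with hy
  have hyk : y k = 1 / 4 := by simp [hy]
  have hzy : ‖z - y‖ = 1 / 4 - z k := by
    have : z - y = -EuclideanSpace.single k (1 / 4 - z k) := by rw [hy]; abel
    rw [this, norm_neg, PiLp.norm_single, Real.norm_of_nonneg (by linarith)]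
  have hyn : ‖y‖ ≤ 3 / 8 := by
    have : ‖y‖ ≤ ‖z‖ + ‖z - y‖ := by
      exact norm_le_norm_add_norm_sub z y
    linarith
  have hnorm : ∀ w, ‖w‖ ≤ 3 / 8 + ‖w - y‖ := fun w => by
    have := norm_le_norm_add_norm_sub' w y
    linarith
  have h := H y ?_ hyk.ge ?_ z ?_
  · rw [hzy] at h
    linarith
  · intro w hw
    rw [mem_closedBall, dist_eq_norm] at hw
    rw [mem_ball_zero_iff]
    linarith [hnorm w]
  · intro w hw _
    rw [mem_closedBall, dist_eq_norm] at hw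
    have hwK : w ∈ K := by
      refine ⟨mem_closedBall_zero_iff.2 (by linarith [hnorm w]), ?_⟩
      have := abs_le.1 (abs_coord_sub_le k w y)
      change 1 / 8 ≤ w k
      linarith [this.1]
    have : m ≤ w k - u w := hmK w hwK
    linarith
  · rw [mem_closedBall, dist_eq_norm]
    linarith

theorem hasFDerivAt_coord_sub_sq (s : ℝ) (k : Fin d) (z : EuclideanSpace ℝ (Fin d)) :
    HasFDerivAt (fun z : EuclideanSpace ℝ (Fin d) => s * z k - z k ^ 2)
      ((s - 2 * z k) • (EuclideanSpace.proj k : EuclideanSpace ℝ (Fin d) →L[ℝ] ℝ)) z := by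
  have h := ((hasFDerivAt_coord k z).const_mul s).sub ((hasFDerivAt_coord k z).pow 2)
  refine h.congr_fderiv ?_
  ext v
  simp
  ring

theorem lapl_coord_sub_sq (s : ℝ) (k : Fin d) (x : EuclideanSpace ℝ (Fin d)) :
    lapl d (fun z => s * z k - z k ^ 2) x = -2 := by
  have hg : ∀ i, HasFDerivAt (fun z : EuclideanSpace ℝ (Fin d) =>
      ((s - 2 * z k) • (EuclideanSpace.proj k : EuclideanSpace ℝ (Fin d) →L[ℝ] ℝ))
        (EuclideanSpace.single i (1 : ℝ)))
      ((EuclideanSpace.single i (1 : ℝ) : EuclideanSpace ℝ (Fin d)) k •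
        (-((2 : ℝ) • (EuclideanSpace.proj k : EuclideanSpace ℝ (Fin d) →L[ℝ] ℝ)))) x := fun i =>
    (((hasFDerivAt_coord k x).const_mul 2).const_sub s).mul_const _
  rw [lapl_eq_sum (hasFDerivAt_coord_sub_sq s k) hg, Finset.sum_eq_single k]
  · simp
  · intro i _ hi
    simp [hi.symm]
  · simp

theorem norm_proj_le (k : Fin d) :
    ‖(EuclideanSpace.proj k : EuclideanSpace ℝ (Fin d) →L[ℝ] ℝ)‖ ≤ 1 :=
  ContinuousLinearMap.opNorm_le_bound _ zero_le_one fun v => by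
    simpa using PiLp.norm_apply_le v k

/-- Strong maximum principle: a viscosity solution below `(x_d)₊` with `0` on the free boundary
equals `(x_d)₊` on the ball. -/
theorem stmt17 (d : ℕ) (hd : 0 < d) (u : EuclideanSpace ℝ (Fin d) → ℝ)
    (hc : ContinuousOn u (Metric.closedBall 0 1))
    (hnn : ∀ x ∈ Metric.closedBall (0 : EuclideanSpace ℝ (Fin d)) 1, 0 ≤ u x)
    (hsol : IsViscSol d (Metric.ball 0 1) (fun _ => 1) u)
    (hup : ∀ x ∈ Metric.ball (0 : EuclideanSpace ℝ (Fin d)) 1,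
      u x ≤ max (x ⟨d - 1, by omega⟩) 0)
    (h0 : (0 : EuclideanSpace ℝ (Fin d)) ∈
      frontier {x ∈ Metric.ball (0 : EuclideanSpace ℝ (Fin d)) 1 | 0 < u x}) :
    ∀ x ∈ Metric.ball (0 : EuclideanSpace ℝ (Fin d)) 1,
      u x = max (x ⟨d - 1, by omega⟩) 0 := by
  obtain ⟨hu, -⟩ := hsol
  set k : Fin d := ⟨d - 1, by omega⟩ with hk
  intro x hx
  by_contra hne
  have hxlt : u x < max (x k) 0 := lt_of_le_of_ne (hup x hx) hne
  have hxk : 0 < x k := by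
    by_contra! h
    rw [max_eq_right h] at hxlt
    exact absurd hxlt (not_lt.2 (hu.2.1 x hx))
  rw [max_eq_left hxk.le] at hxlt
  obtain ⟨c₀, hc₀, H₀⟩ := hu.exists_slope_lt_one k hup
    fun z hz hzk => hu.lt_coord k hup hx hxk hxlt hz hzk
  obtain ⟨c, hc, hc1, hcc₀⟩ : ∃ c : ℝ, 0 < c ∧ c ≤ 1 ∧ c ≤ c₀ :=
    ⟨min c₀ 1, lt_min hc₀ one_pos, min_le_right _ _, min_le_left _ _⟩
  have h0b : (0 : EuclideanSpace ℝ (Fin d)) ∈ ball (0 : EuclideanSpace ℝ (Fin d)) 1 := by simp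
  have hu0 : u 0 = 0 := le_antisymm (by simpa using hup 0 h0b) (hu.2.1 0 h0b)
  have hsm : ContDiff ℝ (⊤ : ℕ∞)
      (fun z : EuclideanSpace ℝ (Fin d) => (1 - c / 2) * z k - z k ^ 2) := by
    have hp : ContDiff ℝ (⊤ : ℕ∞) (fun z : EuclideanSpace ℝ (Fin d) => z k) :=
      (EuclideanSpace.proj k : EuclideanSpace ℝ (Fin d) →L[ℝ] ℝ).contDiff
    exact (contDiff_const.mul hp).sub (hp.pow 2)
  have hloc : IsLocalMaxOn (fun z => u z - max ((1 - c / 2) * z k - z k ^ 2) 0)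
      (ball (0 : EuclideanSpace ℝ (Fin d)) 1) 0 := by
    have hball : ball (0 : EuclideanSpace ℝ (Fin d)) (min (1 / 8) (c / 2)) ∈
        𝓝 (0 : EuclideanSpace ℝ (Fin d)) := ball_mem_nhds _ (lt_min (by norm_num) (half_pos hc))
    filter_upwards [nhdsWithin_le_nhds hball, self_mem_nhdsWithin] with z hz hz1
    rw [mem_ball_zero_iff, lt_min_iff] at hz
    simp only [hu0, PiLp.zero_apply, mul_zero, zero_pow two_ne_zero, sub_zero, max_self]
    rw [sub_nonpos]
    rcases le_total (z k) 0 with hzk | hzk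
    · have := hup z hz1
      rw [max_eq_right hzk] at this
      exact this.trans (le_max_right _ _)
    · refine le_trans ?_ (le_max_left _ _)
      have h1 := H₀ z hz.1 hzk
      have h2 : z k ≤ c / 2 := by
        have := abs_le.1 (abs_coord_sub_le k z 0)
        simp only [sub_zero, PiLp.zero_apply] at this
        linarith [this.2]
      nlinarith
  rcases hu.2.2 _ hsm.contDiffOn 0 ⟨frontier_subset_closure h0, h0b⟩ hloc (by simp [hu0]) with h | h
  · rw [lapl_coord_sub_sq] at h
    norm_num at h
  · have h1 := h.2
    rw [(hasFDerivAt_coord_sub_sq _ k 0).fderiv, norm_smul] at h1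
    simp only [PiLp.zero_apply, mul_zero, sub_zero] at h1
    rw [Real.norm_of_nonneg (by linarith)] at h1
    nlinarith [norm_proj_le k, norm_nonneg (EuclideanSpace.proj k : EuclideanSpace ℝ (Fin d) →L[ℝ] ℝ)]
end
end
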